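/- Let X be a graph-like continuum with vertex set V, and let A and B be disjoint closed subsets of V. Then the maximum number of pairwise edge-disjoint arcs in X each having one endpoint in A and the other endpoint in B equals the minimum cardinality of a cut separating A from B, i.e. the minimum of |E(S, V∖S)| over all separations (S, V∖S) of V with A ⊆ S and B ⊆ V∖S. -/

import Mathlib

open Set Topology Filter Function

universe u

/-- A compact graph-like space structure on a topological space `X`:
a closed zero-dimensional vertex set `V` together with an index type `E`
(carrying the discrete topology) such that `X \ V ≅ E × (0,1)`. -/
structure GraphLike (X : Type u) [TopologicalSpace X] where
  V : Set X
  closedV : IsClosed V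
  zeroDimV : TotallyDisconnectedSpace V
  E : Type
  homeo :
    letI : TopologicalSpace E := ⊥
    Nonempty ((Vᶜ : Set X) ≃ₜ (E × ↥(Set.Ioo (0 : ℝ) 1)))

variable {X : Type u} [TopologicalSpace X]

/-- An edge of a graph-like space: a connected component of `X \ V`. -/
def GraphLike.IsEdge (G : GraphLike X) (e : Set X) : Prop :=
  ∃ x, x ∈ (G.V)ᶜ ∧ e = connectedComponentIn (G.V)ᶜ x

/-- A subset of the vertex set which is clopen in the subspace `V`. -/
def GraphLike.ClopenIn (G : GraphLike X) (C : Set X) : Prop :=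
  C ⊆ G.V ∧ IsClosed C ∧ IsClosed (G.V \ C)

/-- A separation of a graph-like space: a partition of the vertex set into
two disjoint clopen pieces. -/
structure GraphLike.Separation (G : GraphLike X) where
  A : Set X
  B : Set X
  clopenA : G.ClopenIn A
  clopenB : G.ClopenIn B
  disjoint : A ∩ B = ∅
  union : A ∪ B = G.V

/-- The cut induced by a pair of vertex sets: all edges whose closure meets both. -/
def GraphLike.cut (G : GraphLike X) (A B : Set X) : Set (Set X) :=
  {e | G.IsEdge e ∧ (closure e ∩ A).Nonempty ∧ (closure e ∩ B).Nonempty}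

/-- A cut is even if it is finite of even cardinality. -/
def GraphLike.EvenCut (G : GraphLike X) (A B : Set X) : Prop :=
  (G.cut A B).Finite ∧ Even (G.cut A B).ncard

/-- The set of `n` such that there exist `n` pairwise edge-disjoint arcs in `X`, each
with one endpoint in `A` and the other in `B`. -/
def GraphLike.arcConn (G : GraphLike X) (A B : Set X) : Set ℕ :=
  {n | ∃ f : Fin n → unitInterval → X,
    (∀ i, Continuous (f i) ∧ Function.Injective (f i) ∧ f i 0 ∈ A ∧ f i 1 ∈ B) ∧
    ∀ i j, i ≠ j → ∀ e, G.IsEdge e → ¬(e ⊆ Set.range (f i) ∧ e ⊆ Set.range (f j))}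

/-- A vertex `v` has strongly even degree if it has a clopen neighbourhood `C` in `V`
such that for every clopen neighbourhood `A ⊆ C` of `v`, the maximum number of pairwise
edge-disjoint arcs from `V ∖ A` to `v` is even. -/
def GraphLike.StronglyEvenDegree (G : GraphLike X) (v : X) : Prop :=
  ∃ C, G.ClopenIn C ∧ v ∈ C ∧
    ∀ A, G.ClopenIn A → v ∈ A → A ⊆ C →
      ∃ m, IsGreatest (G.arcConn {v} (G.V \ A)) m ∧ Even m

/-- A vertex `v` has strongly odd degree if it has a clopen neighbourhood `C` in `V`
such that for every clopen neighbourhood `A ⊆ C` of `v`, the maximum number of pairwise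
edge-disjoint arcs from `V ∖ A` to `v` is odd. -/
def GraphLike.StronglyOddDegree (G : GraphLike X) (v : X) : Prop :=
  ∃ C, G.ClopenIn C ∧ v ∈ C ∧
    ∀ A, G.ClopenIn A → v ∈ A → A ⊆ C →
      ∃ m, IsGreatest (G.arcConn {v} (G.V \ A)) m ∧ Odd m

def Crs {α W : Type*} (U : Set W) (p q : α → W) (e : α) : Prop :=
  (p e ∈ U ∧ q e ∉ U) ∨ (p e ∉ U ∧ q e ∈ U)

open Classical in
theorem fmenger_glue {α W : Type*} (s t : W) (E : Finset α) (p q : α → W) (k : ℕ)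
    (U : Set W) (hs : s ∈ U) (ht : t ∉ U) (hU : (E.filter (Crs U p q)).card = k)
    (c1 c2 : α → ℕ)
    (h1 : ∀ U' : Set W, s ∈ U' → t ∉ U' → ∀ i < k, ∃ e ∈ E, ¬ (p e ∈ U ∧ q e ∈ U) ∧
      Crs (U' ∪ U) p q e ∧ c1 e = i)
    (h2 : ∀ U' : Set W, s ∈ U' → t ∉ U' → ∀ i < k, ∃ e ∈ E, ¬ (p e ∉ U ∧ q e ∉ U) ∧
      Crs (U' ∩ U) p q e ∧ c2 e = i) :
    ∃ c : α → ℕ, ∀ U' : Set W, s ∈ U' → t ∉ U' → ∀ i < k, ∃ e ∈ E, Crs U' p q e ∧ c e = i := by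
  set T := E.filter (Crs U p q) with hT
  have key : ∀ c : α → ℕ, (∀ i < k, ∃ e ∈ T, c e = i) →
      (∀ e ∈ T, c e < k) ∧ (∀ e ∈ T, ∀ f ∈ T, c e = c f → e = f) := by
    intro c hc
    have hsub : Finset.range k ⊆ T.image c := by
      intro i hi
      obtain ⟨e, he, rfl⟩ := hc i (Finset.mem_range.1 hi)
      exact Finset.mem_image_of_mem _ he
    have heq : Finset.range k = T.image c := by
      apply Finset.eq_of_subset_of_card_le hsub
      rw [Finset.card_range, ← hU]; exact Finset.card_image_le
    constructor
    · intro e he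
      exact Finset.mem_range.1 (heq ▸ Finset.mem_image_of_mem c he)
    · have : Set.InjOn c T := by
        rw [← Finset.card_image_iff, ← heq, Finset.card_range, hU]
      intro e he f hf hef
      exact this he hf hef
  have k1 : ∀ i < k, ∃ e ∈ T, c1 e = i := by
    intro i hi
    obtain ⟨e, he, h, h', h''⟩ := h1 U hs ht i hi
    rw [Set.union_self] at h'
    exact ⟨e, by rw [hT]; exact Finset.mem_filter.2 ⟨he, h'⟩, h''⟩
  have k2 : ∀ i < k, ∃ e ∈ T, c2 e = i := by
    intro i hi
    obtain ⟨e, he, h, h', h''⟩ := h2 U hs ht i hi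
    rw [Set.inter_self] at h'
    exact ⟨e, by rw [hT]; exact Finset.mem_filter.2 ⟨he, h'⟩, h''⟩
  have u1 := key c1 k1
  have u2 := key c2 k2
  have hσ : ∀ i, ∃ j, ∀ e ∈ T, c2 e = i → c1 e = j := by
    intro i
    by_cases h : ∃ e ∈ T, c2 e = i
    · obtain ⟨e, he, rfl⟩ := h
      exact ⟨c1 e, fun f hf hfe => by rw [u2.2 f hf e he hfe]⟩
    · exact ⟨0, fun e he h' => absurd ⟨e, he, h'⟩ h⟩
  choose σ hσ using hσ
  refine ⟨fun e => if p e ∈ U ∧ q e ∈ U then σ (c2 e) else c1 e, ?_⟩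
  intro U' hs' ht' i hi
  obtain ⟨e, heT, hei⟩ := k1 i hi
  have heE : e ∈ E ∧ Crs U p q e := by rw [hT] at heT; exact Finset.mem_filter.1 heT
  have hmemT : ∀ f ∈ E, Crs U p q f → f ∈ T := fun f hf h => by
    rw [hT]; exact Finset.mem_filter.2 ⟨hf, h⟩
  by_cases hc : Crs U' p q e
  · refine ⟨e, heE.1, hc, ?_⟩
    have : ¬ (p e ∈ U ∧ q e ∈ U) := by have := heE.2; unfold Crs at this; tauto
    simp only [this, if_false]; exact hei
  · by_cases hp : p e ∈ U'
    · have hq : q e ∈ U' := by unfold Crs at hc; tauto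
      obtain ⟨f, hf, hfn, hfc, hfi⟩ := h1 U' hs' ht' i hi
      have hfT : ¬ Crs U p q f := by
        intro h
        have : f = e := u1.2 f (hmemT f hf h) e heT (by rw [hfi, hei])
        subst this
        simp only [Crs, Set.mem_union] at hfc; tauto
      refine ⟨f, hf, ?_, ?_⟩
      · simp only [Crs, Set.mem_union] at hfc hfT ⊢; tauto
      · simp only [hfn, if_false]; exact hfi
    · have hq : q e ∉ U' := by unfold Crs at hc; tauto
      obtain ⟨f, hf, hfn, hfc, hfi⟩ := h2 U' hs' ht' (c2 e) (u2.1 e heT)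
      have hfT : ¬ Crs U p q f := by
        intro h
        have : f = e := u2.2 f (hmemT f hf h) e heT hfi
        subst this
        simp only [Crs, Set.mem_inter_iff] at hfc; tauto
      refine ⟨f, hf, ?_, ?_⟩
      · simp only [Crs, Set.mem_inter_iff] at hfc hfT ⊢; tauto
      · have : p f ∈ U ∧ q f ∈ U := by simp only [Crs] at hfT; tauto
        simp only [this, and_self, if_true, hfi]
        rw [← hσ _ e heT rfl, hei]

open Classical in
theorem fmenger {α W : Type*} (s t : W) (n : ℕ) : ∀ (E : Finset α), E.card < n →
    ∀ (p q : α → W) (k : ℕ),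
    (∀ U : Set W, s ∈ U → t ∉ U → k ≤ (E.filter (Crs U p q)).card) →
    ∃ c : α → ℕ, ∀ U : Set W, s ∈ U → t ∉ U → ∀ i < k, ∃ e ∈ E, Crs U p q e ∧ c e = i := by
  induction n with
  | zero => intro E hE; omega
  | succ n ih =>
  intro E hE p q k hk
  by_cases hst : s = t
  · exact ⟨fun _ => 0, fun U h1 h2 => absurd (hst ▸ h1) h2⟩
  -- peeling
  have peel : ∀ P ⊆ E, P.Nonempty → (∀ U : Set W, s ∈ U → t ∉ U →
      (P.filter (Crs U p q)).card = 1) →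
      ∃ c : α → ℕ, ∀ U : Set W, s ∈ U → t ∉ U → ∀ i < k, ∃ e ∈ E, Crs U p q e ∧ c e = i := by
    intro P hPE hP hP1
    obtain ⟨c, hc⟩ := ih (E \ P) (by
      have := Finset.card_sdiff_add_card_eq_card hPE
      have := hP.card_pos
      omega) p q (k - 1) (by
      intro U h1 h2
      have h3 := hk U h1 h2
      have h4 := hP1 U h1 h2
      have h5 : E.filter (Crs U p q) = (E \ P).filter (Crs U p q) ∪ P.filter (Crs U p q) := by
        rw [← Finset.filter_union, Finset.sdiff_union_of_subset hPE]
      have h6 := Finset.card_union_le ((E \ P).filter (Crs U p q)) (P.filter (Crs U p q))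
      rw [← h5] at h6
      omega)
    refine ⟨fun e => if e ∈ P then k - 1 else c e, ?_⟩
    intro U h1 h2 i hi
    by_cases hik : i < k - 1
    · obtain ⟨e, he, h, h'⟩ := hc U h1 h2 i hik
      rw [Finset.mem_sdiff] at he
      exact ⟨e, he.1, h, by simp only [he.2, if_false, h']⟩
    · have : (P.filter (Crs U p q)).Nonempty := by
        rw [← Finset.card_pos, hP1 U h1 h2]; exact one_pos
      obtain ⟨e, he⟩ := this
      rw [Finset.mem_filter] at he
      exact ⟨e, hPE he.1, he.2, by simp only [he.1, if_true]; omega⟩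
  rcases Nat.eq_zero_or_pos k with rfl | hkpos
  · exact ⟨fun _ => 0, fun U _ _ i hi => absurd hi (Nat.not_lt_zero _)⟩
  by_cases hdel : ∃ e ∈ E, ∀ U : Set W, s ∈ U → t ∉ U → k ≤ ((E.erase e).filter (Crs U p q)).card
  · obtain ⟨e, he, h⟩ := hdel
    obtain ⟨c, hc⟩ := ih (E.erase e) (by have := Finset.card_erase_lt_of_mem he; omega) p q k h
    refine ⟨c, fun U h1 h2 i hi => ?_⟩
    obtain ⟨f, hf, h'⟩ := hc U h1 h2 i hi
    exact ⟨f, Finset.mem_of_mem_erase hf, h'⟩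
  push Not at hdel
  have tight : ∀ e ∈ E, ∃ U : Set W, s ∈ U ∧ t ∉ U ∧ Crs U p q e ∧
      (E.filter (Crs U p q)).card = k := by
    intro e he
    obtain ⟨U, h1, h2, h3⟩ := hdel e he
    rw [Finset.filter_erase] at h3
    have h4 := hk U h1 h2
    by_cases hce : e ∈ E.filter (Crs U p q)
    · rw [Finset.card_erase_of_mem hce] at h3
      exact ⟨U, h1, h2, (Finset.mem_filter.1 hce).2, by omega⟩
    · rw [Finset.erase_eq_of_notMem hce] at h3; omega
  by_cases hgl : ∃ U : Set W, s ∈ U ∧ t ∉ U ∧ (E.filter (Crs U p q)).card = k ∧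
      (∃ e ∈ E, p e ∈ U ∧ q e ∈ U) ∧ (∃ e ∈ E, p e ∉ U ∧ q e ∉ U)
  · obtain ⟨U, hs, ht, hU, ⟨a, haE, ha⟩, ⟨b, hbE, hb⟩⟩ := hgl
    have e1 : ∀ U' : Set W, s ∈ U' → ∀ e, Crs U' (fun e => if p e ∈ U then s else p e)
        (fun e => if q e ∈ U then s else q e) e ↔ Crs (U' ∪ U) p q e := by
      intro U' hs' e
      simp only [Crs, Set.mem_union]
      split_ifs <;> simp_all
    have e2 : ∀ U' : Set W, t ∉ U' → ∀ e, Crs U' (fun e => if p e ∈ U then p e else t)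
        (fun e => if q e ∈ U then q e else t) e ↔ Crs (U' ∩ U) p q e := by
      intro U' hs' e
      simp only [Crs, Set.mem_inter_iff]
      split_ifs <;> simp_all
    obtain ⟨c1, hc1⟩ := ih (E.filter fun e => ¬ (p e ∈ U ∧ q e ∈ U)) (by
        have : (E.filter fun e => ¬ (p e ∈ U ∧ q e ∈ U)) ⊂ E := by
          rw [Finset.filter_ssubset]; exact ⟨a, haE, by tauto⟩
        have := Finset.card_lt_card this
        omega) (fun e => if p e ∈ U then s else p e) (fun e => if q e ∈ U then s else q e) k (by
        intro U' hs' ht'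
        refine (hk (U' ∪ U) (Or.inl hs') (by simp [ht, ht'])).trans (Finset.card_le_card ?_)
        intro e he
        rw [Finset.mem_filter] at he
        rw [Finset.mem_filter, Finset.mem_filter, e1 U' hs']
        refine ⟨⟨he.1, ?_⟩, he.2⟩
        have := he.2
        simp only [Crs, Set.mem_union] at this; tauto)
    obtain ⟨c2, hc2⟩ := ih (E.filter fun e => ¬ (p e ∉ U ∧ q e ∉ U)) (by
        have : (E.filter fun e => ¬ (p e ∉ U ∧ q e ∉ U)) ⊂ E := by
          rw [Finset.filter_ssubset]; exact ⟨b, hbE, by tauto⟩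
        have := Finset.card_lt_card this
        omega) (fun e => if p e ∈ U then p e else t) (fun e => if q e ∈ U then q e else t) k (by
        intro U' hs' ht'
        refine (hk (U' ∩ U) ⟨hs', hs⟩ (by simp [ht'])).trans (Finset.card_le_card ?_)
        intro e he
        rw [Finset.mem_filter] at he
        rw [Finset.mem_filter, Finset.mem_filter, e2 U' ht']
        refine ⟨⟨he.1, ?_⟩, he.2⟩
        have := he.2
        simp only [Crs, Set.mem_inter_iff] at this; tauto)
    refine fmenger_glue s t E p q k U hs ht hU c1 c2 ?_ ?_
    · intro U' hs' ht' i hi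
      obtain ⟨e, he, h, h'⟩ := hc1 U' hs' ht' i hi
      rw [Finset.mem_filter] at he
      exact ⟨e, he.1, he.2, (e1 U' hs' e).1 h, h'⟩
    · intro U' hs' ht' i hi
      obtain ⟨e, he, h, h'⟩ := hc2 U' hs' ht' i hi
      rw [Finset.mem_filter] at he
      exact ⟨e, he.1, he.2, (e2 U' ht' e).1 h, h'⟩
  have inc : ∀ e ∈ E, Crs {s} p q e ∨ Crs {t}ᶜ p q e := by
    intro e he
    obtain ⟨U, hs, ht, hce, hU⟩ := tight e he
    have heU : e ∈ E.filter (Crs U p q) := Finset.mem_filter.2 ⟨he, hce⟩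
    by_cases hin : ∃ e ∈ E, p e ∈ U ∧ q e ∈ U
    · have hout : ∀ e ∈ E, ¬ (p e ∉ U ∧ q e ∉ U) := fun e he h =>
        hgl ⟨U, hs, ht, hU, hin, e, he, h⟩
      right
      have hsub : E.filter (Crs {t}ᶜ p q) ⊆ E.filter (Crs U p q) := by
        intro f hf
        rw [Finset.mem_filter] at hf ⊢
        refine ⟨hf.1, ?_⟩
        have h1 := hout f hf.1
        have h2 := hf.2
        simp only [Crs, Set.mem_compl_iff, Set.mem_singleton_iff] at h2 ⊢
        grind
      have := Finset.eq_of_subset_of_card_le hsub (by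
        rw [hU]; exact hk _ (by simpa using hst) (by simp))
      rw [← this, Finset.mem_filter] at heU
      exact heU.2
    · left
      have hsub : E.filter (Crs {s} p q) ⊆ E.filter (Crs U p q) := by
        intro f hf
        rw [Finset.mem_filter] at hf ⊢
        refine ⟨hf.1, ?_⟩
        have h1 : ¬ (p f ∈ U ∧ q f ∈ U) := fun h => hin ⟨f, hf.1, h⟩
        have h2 := hf.2
        simp only [Crs, Set.mem_singleton_iff] at h2 ⊢
        grind
      have := Finset.eq_of_subset_of_card_le hsub (by
        rw [hU]; exact hk _ (by simp) (by simpa using fun h => hst h.symm))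
      rw [← this, Finset.mem_filter] at heU
      exact heU.2
  by_cases hst' : ∃ e ∈ E, (p e = s ∧ q e = t) ∨ (p e = t ∧ q e = s)
  · obtain ⟨e, he, h⟩ := hst'
    refine peel {e} (by simpa using he) (by simp) ?_
    intro U h1 h2
    have : Crs U p q e := by unfold Crs; grind
    rw [Finset.filter_singleton, if_pos this, Finset.card_singleton]
  · have hne := hk ({s} ∪ {v | ∃ e ∈ E, (p e = s ∧ q e = v) ∨ (p e = v ∧ q e = s)})
      (by simp) (by
        rintro (h | h)
        · exact hst h.symm
        · exact hst' h)
    have hne := Finset.card_pos.1 (lt_of_lt_of_le hkpos hne)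
    obtain ⟨e, he⟩ := hne
    rw [Finset.mem_filter] at he
    obtain ⟨heE, hec⟩ := he
    have : ∃ f ∈ E, ∃ x, x ≠ s ∧ x ≠ t ∧ ((p f = s ∧ q f = x) ∨ (p f = x ∧ q f = s)) ∧
        ((p e = t ∧ q e = x) ∨ (p e = x ∧ q e = t)) := by
      have := inc e heE
      simp only [Crs, Set.mem_union, Set.mem_singleton_iff, Set.mem_ofPred_eq,
        Set.mem_compl_iff] at this hec
      by_cases hsx : p e = s ∨ q e = s
      · exfalso; grind
      · clear hdel tight hgl peel ih hk inc
        push Not at hsx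
        rcases hec with ⟨h1, h2⟩ | ⟨h1, h2⟩
        · rcases h1 with h1 | ⟨f, hf, h1⟩
          · exact absurd h1 hsx.1
          · exact ⟨f, hf, p e, by grind⟩
        · rcases h2 with h2 | ⟨f, hf, h2⟩
          · exact absurd h2 hsx.2
          · exact ⟨f, hf, q e, by grind⟩
    obtain ⟨f, hf, x, hxs, hxt, h1, h2⟩ := this
    have hfe : e ≠ f := by rintro rfl; grind
    refine peel {e, f} (by intro g; simp only [Finset.mem_insert, Finset.mem_singleton]; grind)
      (by simp) ?_
    intro U hs ht
    rw [Finset.card_eq_one]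
    by_cases hx : x ∈ U
    · refine ⟨e, ?_⟩
      ext g
      simp only [Crs, Finset.mem_filter, Finset.mem_insert, Finset.mem_singleton]
      grind
    · refine ⟨f, ?_⟩
      ext g
      simp only [Crs, Finset.mem_filter, Finset.mem_insert, Finset.mem_singleton]
      grind

/-- a parametrised graph-like space -/
structure GPar (X : Type u) [TopologicalSpace X] where
  V : Set X
  E : Type
  γ : E → ℝ → X
  closedV : IsClosed V
  tdV : TotallyDisconnectedSpace V
  cont : ∀ e, ContinuousOn (γ e) (Icc 0 1)
  inj : ∀ e, InjOn (γ e) (Ioo 0 1)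
  op : ∀ e, IsOpen (γ e '' Ioo 0 1)
  sub : ∀ e, ∀ r ∈ Ioo (0:ℝ) 1, γ e r ∉ V
  disj : ∀ e f, ∀ r ∈ Ioo (0:ℝ) 1, ∀ s ∈ Ioo (0:ℝ) 1, γ e r = γ f s → e = f
  cov : ∀ x ∉ V, ∃ e, ∃ r ∈ Ioo (0:ℝ) 1, γ e r = x
  z : ∀ e, γ e 0 ∈ V
  o : ∀ e, γ e 1 ∈ V

theorem sepV {X : Type u} [TopologicalSpace X] [CompactSpace X] [T2Space X] {V A B : Set X}
    (hV : IsClosed V) (td : TotallyDisconnectedSpace V) (hA : IsClosed A) (hB : IsClosed B)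
    (hAV : A ⊆ V) (hAB : Disjoint A B) :
    ∃ C ⊆ V, IsClosed C ∧ IsClosed (V \ C) ∧ A ⊆ C ∧ Disjoint C B := by
  haveI : CompactSpace V := isCompact_iff_compactSpace.1 hV.isCompact
  have h1 : ∀ x : A, ∃ C : Set V, IsClopen C ∧ (⟨x, hAV x.2⟩ : V) ∈ C ∧
      C ⊆ ((↑) : V → X) ⁻¹' Bᶜ := by
    intro x
    obtain ⟨C, h, h', h''⟩ := compact_exists_isClopen_in_isOpen (X := V) (x := ⟨x, hAV x.2⟩)
      (U := ((↑) : V → X) ⁻¹' Bᶜ) (hB.isOpen_compl.preimage continuous_subtype_val)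
      (fun h => hAB.le_bot ⟨x.2, h⟩)
    exact ⟨C, h, h', h''⟩
  choose C hC hxC hCB using h1
  have hcomp : IsCompact (((↑) : V → X) ⁻¹' A) :=
    (hA.preimage continuous_subtype_val).isCompact
  obtain ⟨t, ht⟩ := hcomp.elim_finite_subcover C (fun x => (hC x).isOpen) (by
    intro y hy
    exact mem_iUnion.2 ⟨⟨y, hy⟩, hxC ⟨y, hy⟩⟩)
  have hD : IsClopen (⋃ i ∈ t, C i) := t.finite_toSet.isClopen_biUnion (fun i _ => hC i)
  refine ⟨(↑) '' (⋃ i ∈ t, C i), ?_, ?_, ?_, ?_, ?_⟩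
  · rintro _ ⟨y, _, rfl⟩; exact y.2
  · exact hV.isClosedEmbedding_subtypeVal.isClosedMap _ hD.isClosed
  · have : V \ (((↑) : V → X) '' (⋃ i ∈ t, C i)) = (↑) '' (⋃ i ∈ t, C i)ᶜ := by
      ext y; constructor
      · rintro ⟨h, h'⟩
        exact ⟨⟨y, h⟩, fun h'' => h' ⟨_, h'', rfl⟩, rfl⟩
      · rintro ⟨w, hw, rfl⟩
        refine ⟨w.2, ?_⟩
        rintro ⟨w', hw', h⟩
        exact hw (Subtype.ext h ▸ hw')
    rw [this]
    exact hV.isClosedEmbedding_subtypeVal.isClosedMap _ hD.compl.isClosed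
  · intro x hx
    exact ⟨⟨x, hAV hx⟩, ht hx, rfl⟩
  · rw [Set.disjoint_left]
    rintro _ ⟨y, hy, rfl⟩ h
    simp only [mem_iUnion] at hy
    obtain ⟨i, _, hi⟩ := hy
    exact hCB i hi h

theorem endlim {X : Type u} [TopologicalSpace X] [CompactSpace X] [T2Space X] {V : Set X}
    (hV : IsClosed V) (td : TotallyDisconnectedSpace V) (φ : ℝ → X)
    (hφ : ContinuousOn φ (Ioo 0 1))
    (hK : ∀ K : Set X, IsClosed K → Disjoint K V → ∃ δ > 0, ∀ r ∈ Ioo (0:ℝ) 1, φ r ∈ K → δ ≤ r) :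
    ∃ v ∈ V, Tendsto φ (𝓝[>] 0) (𝓝 v) := by
  have ev : ∀ K : Set X, IsClosed K → Disjoint K V → ∀ᶠ r in 𝓝[>] (0:ℝ), φ r ∉ K := by
    intro K h1 h2
    obtain ⟨δ, hδ, h⟩ := hK K h1 h2
    filter_upwards [Ioo_mem_nhdsGT (lt_min hδ one_pos)] with r hr hrK
    have := h r ⟨hr.1, hr.2.trans_le (min_le_right _ _)⟩ hrK
    exact absurd (hr.2.trans_le (min_le_left _ _)) (not_lt.2 this)
  have clV : ∀ v, ClusterPt v (map φ (𝓝[>] 0)) → v ∈ V := by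
    intro v hv
    by_contra hvV
    obtain ⟨K, hKn, hKc, hKs⟩ := exists_mem_nhds_isClosed_subset (hV.isOpen_compl.mem_nhds hvV)
    have h1 := ev K hKc (disjoint_left.2 hKs)
    have h2 : ∃ᶠ x in map φ (𝓝[>] 0), x ∈ K := hv.frequently hKn
    rw [frequently_map] at h2
    obtain ⟨r, hr, hr'⟩ := (h2.and_eventually h1).exists
    exact hr' hr
  obtain ⟨v, hv⟩ := exists_clusterPt_of_compactSpace (map φ (𝓝[>] (0:ℝ)))
  refine ⟨v, clV v hv, ?_⟩
  apply le_nhds_of_unique_clusterPt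
  intro w hw
  by_contra hne
  have hvV := clV v hv
  have hwV := clV w hw
  obtain ⟨C, hCV, hC, hC', hwC, hvC⟩ := sepV hV td (isClosed_singleton (x := w))
    (isClosed_singleton (x := v)) (by simpa using hwV) (by simpa using hne)
  obtain ⟨U, W, hU, hW, hCU, hCW, hUW⟩ := SeparatedNhds.of_isCompact_isCompact hC.isCompact hC'.isCompact
    disjoint_sdiff_self_right
  obtain ⟨δ, hδ, h⟩ := hK (U ∪ W)ᶜ (hU.union hW).isClosed_compl (by
    rw [disjoint_left]
    intro x hx hxV
    by_cases hxC : x ∈ C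
    · exact hx (Or.inl (hCU hxC))
    · exact hx (Or.inr (hCW ⟨hxV, hxC⟩)))
  have hsub : φ '' Ioo 0 (min δ 1) ⊆ U ∪ W := by
    rintro _ ⟨r, hr, rfl⟩
    by_contra hcon
    have := h r ⟨hr.1, hr.2.trans_le (min_le_right _ _)⟩ hcon
    exact absurd (hr.2.trans_le (min_le_left _ _)) (not_lt.2 this)
  have hpre : IsPreconnected (φ '' Ioo 0 (min δ 1)) :=
    isPreconnected_Ioo.image _ (hφ.mono (Ioo_subset_Ioo_right (min_le_right _ _)))
  have hev : ∀ᶠ r in 𝓝[>] (0:ℝ), φ r ∈ φ '' Ioo 0 (min δ 1) := by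
    filter_upwards [Ioo_mem_nhdsGT (lt_min hδ one_pos)] with r hr using mem_image_of_mem _ hr
  have bad : ∀ (x : X) (Y Z : Set X), ClusterPt x (map φ (𝓝[>] (0:ℝ))) → IsOpen Y → x ∈ Y →
      Disjoint Z Y → ¬ (φ '' Ioo 0 (min δ 1) ⊆ Z) := by
    intro x Y Z hx hY hxY hd hZ
    have h2 : ∃ᶠ x in map φ (𝓝[>] 0), x ∈ Y := hx.frequently (hY.mem_nhds hxY)
    rw [frequently_map] at h2
    obtain ⟨r, hr, hr'⟩ := (h2.and_eventually hev).exists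
    exact hd.le_bot ⟨hZ hr', hr⟩
  rcases hpre.subset_or_subset hU hW hUW hsub with h | h
  · exact bad v W U hv hW (hCW ⟨hvV, fun h => hvC.le_bot ⟨h, rfl⟩⟩) hUW h
  · exact bad w U W hw hU (hCU (hwC rfl)) hUW.symm h

theorem GraphLike.exists_gpar {X : Type u} [TopologicalSpace X] [CompactSpace X] [T2Space X]
    (V : Set X) (hV : IsClosed V) (td : TotallyDisconnectedSpace V) (E : Type)
    (hom : letI : TopologicalSpace E := ⊥
      Nonempty ((Vᶜ : Set X) ≃ₜ (E × ↥(Set.Ioo (0 : ℝ) 1)))) :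
    ∃ P : GPar X, P.V = V := by
  letI : TopologicalSpace E := ⊥
  haveI : DiscreteTopology E := ⟨rfl⟩
  obtain ⟨h⟩ := hom
  classical
  let φ : E → ℝ → X := fun e r =>
    if hr : r ∈ Ioo (0:ℝ) 1 then (h.symm (e, ⟨r, hr⟩) : (Vᶜ : Set X)) else h.symm (e, ⟨1/2, by norm_num, by norm_num⟩)
  have φeq : ∀ e r (hr : r ∈ Ioo (0:ℝ) 1), φ e r = (h.symm (e, ⟨r, hr⟩) : (Vᶜ : Set X)) := by
    intro e r hr; simp only [φ, dif_pos hr]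
  have φc : ∀ e, ContinuousOn (φ e) (Ioo 0 1) := by
    intro e
    rw [continuousOn_iff_continuous_domRestrict]
    have : (Ioo (0:ℝ) 1).domRestrict (φ e) = fun r => ((h.symm (e, r) : (Vᶜ : Set X)) : X) := by
      ext r; exact φeq e r r.2
    rw [this]
    fun_prop
  have hK : ∀ e, ∀ K : Set X, IsClosed K → Disjoint K V →
      ∃ δ > 0, ∀ r ∈ Ioo (0:ℝ) 1, φ e r ∈ K → δ ≤ r ∧ r ≤ 1 - δ := by
    intro e K hKc hKV
    have c1 : IsCompact (((↑) : (Vᶜ : Set X) → X) ⁻¹' K) := by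
      rw [Subtype.isCompact_iff, Subtype.image_preimage_coe]
      have hs : K ⊆ Vᶜ := fun x hx hxV => hKV.le_bot ⟨hx, hxV⟩
      rw [inter_eq_right.2 hs]
      exact hKc.isCompact
    have c2 : IsCompact ((fun y => ((h y).2 : ℝ)) '' (((↑) : (Vᶜ : Set X) → X) ⁻¹' K)) :=
      c1.image (by fun_prop)
    rcases (((fun y => ((h y).2 : ℝ)) '' (((↑) : (Vᶜ : Set X) → X) ⁻¹' K))).eq_empty_or_nonempty with he | hne
    · refine ⟨1, one_pos, fun r hr hrK => ?_⟩
      exfalso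
      have : r ∈ (fun y => ((h y).2 : ℝ)) '' (((↑) : (Vᶜ : Set X) → X) ⁻¹' K) :=
        ⟨h.symm (e, ⟨r, hr⟩), by rw [mem_preimage, ← φeq]; exact hrK, by simp⟩
      rw [he] at this; exact this
    · obtain ⟨m, hm⟩ := c2.exists_isLeast hne
      obtain ⟨M, hM⟩ := c2.exists_isGreatest hne
      have hm0 : 0 < m := by obtain ⟨y, _, hy⟩ := hm.1; rw [← hy]; exact (h y).2.2.1
      have hM1 : M < 1 := by obtain ⟨y, _, hy⟩ := hM.1; rw [← hy]; exact (h y).2.2.2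
      refine ⟨min m (1 - M), lt_min hm0 (by linarith), fun r hr hrK => ?_⟩
      have : r ∈ (fun y => ((h y).2 : ℝ)) '' (((↑) : (Vᶜ : Set X) → X) ⁻¹' K) :=
        ⟨h.symm (e, ⟨r, hr⟩), by rw [mem_preimage, ← φeq]; exact hrK, by simp⟩
      have h1 := hm.2 this
      have h2 := hM.2 this
      have := min_le_left m (1 - M)
      have := min_le_right m (1 - M)
      constructor <;> linarith
  have e0 : ∀ e, ∃ v ∈ V, Tendsto (φ e) (𝓝[>] 0) (𝓝 v) := by
    intro e
    refine endlim hV td _ (φc e) ?_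
    intro K h1 h2
    obtain ⟨δ, hδ, h⟩ := hK e K h1 h2
    exact ⟨δ, hδ, fun r hr hrK => (h r hr hrK).1⟩
  have e1 : ∀ e, ∃ v ∈ V, Tendsto (φ e) (𝓝[<] 1) (𝓝 v) := by
    intro e
    obtain ⟨v, hv, h⟩ := endlim hV td (fun r => φ e (1 - r)) ((φc e).comp (by fun_prop) (by
      intro r hr; exact ⟨by linarith [hr.2], by linarith [hr.1]⟩)) (by
      intro K h1 h2
      obtain ⟨δ, hδ, h⟩ := hK e K h1 h2
      refine ⟨δ, hδ, fun r hr hrK => ?_⟩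
      have := (h (1 - r) ⟨by linarith [hr.2], by linarith [hr.1]⟩ hrK).2
      linarith)
    refine ⟨v, hv, ?_⟩
    have : Tendsto (fun r : ℝ => 1 - r) (𝓝[<] 1) (𝓝[>] 0) := by
      rw [tendsto_nhdsWithin_iff]
      constructor
      · have : Tendsto (fun r : ℝ => 1 - r) (𝓝 1) (𝓝 (1 - 1)) := by
          apply Continuous.tendsto; fun_prop
        rw [sub_self] at this
        exact this.mono_left nhdsWithin_le_nhds
      · filter_upwards [self_mem_nhdsWithin] with r hr
        simpa using hr
    have := h.comp this
    simpa [Function.comp_def] using this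
  choose p hp hp' using e0
  choose q hq hq' using e1
  let g : E → ℝ → X := fun e r => if r ≤ 0 then p e else if 1 ≤ r then q e else φ e r
  have geq : ∀ e r, r ∈ Ioo (0:ℝ) 1 → g e r = φ e r := by
    intro e r hr
    simp only [g, if_neg (not_le.2 hr.1), if_neg (not_le.2 hr.2)]
  have geq' : ∀ e r (hr : r ∈ Ioo (0:ℝ) 1), g e r = (h.symm (e, ⟨r, hr⟩) : (Vᶜ : Set X)) :=
    fun e r hr => by rw [geq e r hr, φeq e r hr]
  have g0 : ∀ e, g e 0 = p e := fun e => by simp [g]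
  have g1 : ∀ e, g e 1 = q e := fun e => by simp [g]
  have inj2 : ∀ e f, ∀ r ∈ Ioo (0:ℝ) 1, ∀ s ∈ Ioo (0:ℝ) 1, g e r = g f s → e = f ∧ r = s := by
    intro e f r hr s hs hrs
    rw [geq' e r hr, geq' f s hs] at hrs
    have := h.symm.injective (Subtype.ext hrs)
    simpa using this
  refine ⟨⟨V, E, g, hV, td, ?_, ?_, ?_, ?_, ?_, ?_, ?_, ?_⟩, rfl⟩
  · intro e x hx
    have hsub : Ioo (0:ℝ) 1 ∈ 𝓝[>] (0:ℝ) := Ioo_mem_nhdsGT one_pos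
    rcases eq_or_lt_of_le hx.1 with rfl | h0
    · have : ContinuousWithinAt (g e) (Ioi 0) 0 := by
        rw [ContinuousWithinAt, g0]
        refine (hp' e).congr' ?_
        filter_upwards [Ioo_mem_nhdsGT (one_pos : (0:ℝ) < 1)] with r hr
        exact (geq e r hr).symm
      exact (continuousWithinAt_Ioi_iff_Ici.1 this).mono Icc_subset_Ici_self
    rcases eq_or_lt_of_le hx.2 with rfl | h1
    · have : ContinuousWithinAt (g e) (Iio 1) 1 := by
        rw [ContinuousWithinAt, g1]
        refine (hq' e).congr' ?_
        filter_upwards [Ioo_mem_nhdsLT (one_pos : (0:ℝ) < 1)] with r hr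
        exact (geq e r hr).symm
      exact (continuousWithinAt_Iio_iff_Iic.1 this).mono Icc_subset_Iic_self
    · apply ContinuousAt.continuousWithinAt
      refine ((φc e).continuousAt (Ioo_mem_nhds h0 h1)).congr ?_
      filter_upwards [Ioo_mem_nhds h0 h1] with r hr
      exact (geq e r hr).symm
  · intro e r hr s hs hrs
    exact (inj2 e e r hr s hs hrs).2
  · intro e
    have : g e '' Ioo 0 1 = ((↑) : (Vᶜ : Set X) → X) '' (h ⁻¹' (Prod.fst ⁻¹' {e})) := by
      ext x; constructor
      · rintro ⟨r, hr, rfl⟩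
        exact ⟨h.symm (e, ⟨r, hr⟩), by simp, (geq' e r hr).symm⟩
      · rintro ⟨y, hy, rfl⟩
        refine ⟨(h y).2, (h y).2.2, ?_⟩
        rw [geq' e _ (h y).2.2]
        congr 1
        apply h.injective
        rw [h.apply_symm_apply]
        have : (h y).1 = e := hy
        rw [← this]
    rw [this]
    apply hV.isOpen_compl.isOpenMap_subtype_val
    apply (IsOpen.preimage continuous_fst (isOpen_discrete _)).preimage h.continuous
  · intro e r hr
    show g e r ∉ V
    rw [geq' e r hr]
    exact (h.symm (e, ⟨r, hr⟩)).2
  · intro e f r hr s hs hrs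
    exact (inj2 e f r hr s hs hrs).1
  · intro x hx
    refine ⟨(h ⟨x, hx⟩).1, (h ⟨x, hx⟩).2, (h ⟨x, hx⟩).2.2, ?_⟩
    show g _ _ = x
    rw [geq' _ _ (h ⟨x, hx⟩).2.2]
    simp
  · intro e; show g e 0 ∈ V; rw [g0]; exact hp e
  · intro e; show g e 1 ∈ V; rw [g1]; exact hq e

namespace GPar

/-- open edge -/
def ed (P : GPar X) (e : P.E) : Set X := P.γ e '' Ioo 0 1
/-- closed edge -/
def cl (P : GPar X) (e : P.E) : Set X := P.γ e '' Icc 0 1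
/-- clopen vertex sets -/
def Clo (P : GPar X) (C : Set X) : Prop := C ⊆ P.V ∧ IsClosed C ∧ IsClosed (P.V \ C)
/-- the edge crosses the vertex set -/
def Ct (P : GPar X) (C : Set X) (e : P.E) : Prop :=
  Crs C (fun e => P.γ e 0) (fun e => P.γ e 1) e
/-- one side of a vertex set -/
def side (P : GPar X) (C : Set X) : Set X :=
  C ∪ {x | ∃ e, x ∈ P.ed e ∧ P.γ e 0 ∈ C ∧ P.γ e 1 ∈ C}

theorem ed_unique (P : GPar X) {e f : P.E} {x : X} (h1 : x ∈ P.ed e) (h2 : x ∈ P.ed f) : e = f := by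
  obtain ⟨r, hr, rfl⟩ := h1
  obtain ⟨s, hs, h⟩ := h2
  exact (P.disj f e s hs r hr h).symm

theorem ed_notV (P : GPar X) {e : P.E} {x : X} (h1 : x ∈ P.ed e) : x ∉ P.V := by
  obtain ⟨r, hr, rfl⟩ := h1
  exact P.sub e r hr

theorem ed_ne (P : GPar X) (e : P.E) : (P.ed e).Nonempty :=
  ⟨P.γ e (1/2), 1/2, by norm_num, rfl⟩

theorem ed_pre (P : GPar X) (e : P.E) : IsPreconnected (P.ed e) :=
  isPreconnected_Ioo.image _ ((P.cont e).mono Ioo_subset_Icc_self)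

theorem ed_cov (P : GPar X) {x : X} (h : x ∉ P.V) : ∃ e, x ∈ P.ed e := by
  obtain ⟨e, r, hr, h⟩ := P.cov x h
  exact ⟨e, r, hr, h⟩

theorem ed_sub_cl (P : GPar X) (e : P.E) : P.ed e ⊆ P.cl e := image_mono Ioo_subset_Icc_self

theorem z_mem_cl (P : GPar X) (e : P.E) : P.γ e 0 ∈ P.cl e := ⟨0, by simp, rfl⟩
theorem o_mem_cl (P : GPar X) (e : P.E) : P.γ e 1 ∈ P.cl e := ⟨1, by simp, rfl⟩

theorem mem_cl (P : GPar X) {e : P.E} {x : X} (h : x ∈ P.cl e) :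
    x ∈ P.ed e ∨ x = P.γ e 0 ∨ x = P.γ e 1 := by
  obtain ⟨r, hr, rfl⟩ := h
  rcases eq_or_lt_of_le hr.1 with rfl | h0
  · tauto
  rcases eq_or_lt_of_le hr.2 with rfl | h1
  · tauto
  · exact Or.inl ⟨r, ⟨h0, h1⟩, rfl⟩

theorem cl_closed [T2Space X] (P : GPar X) (e : P.E) : IsClosed (P.cl e) :=
  (isCompact_Icc.image_of_continuousOn (P.cont e)).isClosed

theorem cl_eq [T2Space X] (P : GPar X) (e : P.E) : closure (P.ed e) = P.cl e := by
  apply Subset.antisymm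
  · exact closure_minimal (P.ed_sub_cl e) (P.cl_closed e)
  · have h : closure (Ioo (0:ℝ) 1) = Icc 0 1 := closure_Ioo zero_ne_one
    have := ContinuousOn.image_closure (f := P.γ e) (s := Ioo 0 1) (by rw [h]; exact P.cont e)
    rwa [h] at this

theorem Clo.compl {P : GPar X} {C : Set X} (h : P.Clo C) : P.Clo (P.V \ C) :=
  ⟨diff_subset, h.2.2, by rw [diff_diff_cancel_left h.1]; exact h.2.1⟩

theorem ct_compl (P : GPar X) (C : Set X) (e : P.E) : P.Ct (P.V \ C) e ↔ P.Ct C e := by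
  have h0 := P.z e
  have h1 := P.o e
  simp only [Ct, Crs, mem_diff]; tauto

theorem fin_out [CompactSpace X] (P : GPar X) {K : Set X} (hK : IsClosed K) (hKV : Disjoint K P.V) :
    {e | (P.ed e ∩ K).Nonempty}.Finite := by
  obtain ⟨t, ht⟩ := hK.isCompact.elim_finite_subcover P.ed P.op (by
    intro x hx
    obtain ⟨e, he⟩ := P.ed_cov (fun h => hKV.le_bot ⟨hx, h⟩)
    exact mem_iUnion.2 ⟨e, he⟩)
  refine t.finite_toSet.subset ?_
  rintro e ⟨x, hxe, hxK⟩
  have := ht hxK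
  simp only [mem_iUnion] at this
  obtain ⟨f, hf, hxf⟩ := this
  rw [P.ed_unique hxe hxf]; exact hf

theorem nbhd [CompactSpace X] [T2Space X] (P : GPar X) {C : Set X} (hC : P.Clo C) :
    ∃ U W : Set X, IsOpen U ∧ IsOpen W ∧ Disjoint U W ∧ C ⊆ U ∧ P.V \ C ⊆ W ∧
      {e | ¬ P.ed e ⊆ U ∧ ¬ P.ed e ⊆ W}.Finite := by
  obtain ⟨U, W, hU, hW, hCU, hCW, hUW⟩ := SeparatedNhds.of_isCompact_isCompact
    hC.2.1.isCompact hC.2.2.isCompact disjoint_sdiff_self_right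
  refine ⟨U, W, hU, hW, hUW, hCU, hCW, ?_⟩
  refine (P.fin_out (K := (U ∪ W)ᶜ) (hU.union hW).isClosed_compl ?_).subset ?_
  · rw [disjoint_left]
    intro x hx hxV
    by_cases hxC : x ∈ C
    · exact hx (Or.inl (hCU hxC))
    · exact hx (Or.inr (hCW ⟨hxV, hxC⟩))
  · rintro e ⟨h1, h2⟩
    by_contra hcon
    have hsub : P.ed e ⊆ U ∪ W := by
      intro x hx
      by_contra h
      exact hcon ⟨x, hx, h⟩
    rcases (P.ed_pre e).subset_or_subset hU hW hUW hsub with h | h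
    · exact h1 h
    · exact h2 h

theorem cl_disj [T2Space X] (P : GPar X) {e : P.E} {U W : Set X} (hW : IsOpen W)
    (hd : Disjoint U W) (h : P.ed e ⊆ U) {x : X} (hx : x ∈ P.cl e) : x ∉ W := by
  rw [← P.cl_eq] at hx
  have := closure_mono h hx
  exact fun hxW => (hd.closure_left hW).le_bot ⟨this, hxW⟩

theorem cut_finite [CompactSpace X] [T2Space X] (P : GPar X) {C : Set X} (hC : P.Clo C) :
    {e | P.Ct C e}.Finite := by
  obtain ⟨U, W, hU, hW, hUW, hCU, hCW, hfin⟩ := P.nbhd hC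
  refine hfin.subset ?_
  intro e he
  have h0 := P.z_mem_cl e
  have h1 := P.o_mem_cl e
  have hz := P.z e
  have ho := P.o e
  constructor
  · intro h
    rcases he with ⟨ha, hb⟩ | ⟨ha, hb⟩
    · exact P.cl_disj hW hUW h h1 (hCW ⟨ho, hb⟩)
    · exact P.cl_disj hW hUW h h0 (hCW ⟨hz, ha⟩)
  · intro h
    rcases he with ⟨ha, hb⟩ | ⟨ha, hb⟩
    · exact P.cl_disj hU hUW.symm h h0 (hCU ha)
    · exact P.cl_disj hU hUW.symm h h1 (hCU hb)

theorem side_closed [CompactSpace X] [T2Space X] (P : GPar X) {C : Set X} (hC : P.Clo C) :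
    IsClosed (P.side C) := by
  obtain ⟨U, W, hU, hW, hUW, hCU, hCW, hfin⟩ := P.nbhd hC
  set J := {e | ¬ P.ed e ⊆ U ∧ ¬ P.ed e ⊆ W} ∩ {e | P.γ e 0 ∈ C ∧ P.γ e 1 ∈ C} with hJ
  have hJf : J.Finite := hfin.subset inter_subset_left
  have hcl : IsClosed (Wᶜ ∪ ⋃ e ∈ J, P.cl e) :=
    hW.isClosed_compl.union (hJf.isClosed_biUnion fun e _ => P.cl_closed e)
  have hsub : P.side C ⊆ Wᶜ ∪ ⋃ e ∈ J, P.cl e := by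
    rintro x (hx | ⟨e, hxe, h0, h1⟩)
    · exact Or.inl fun h => hUW.le_bot ⟨hCU hx, h⟩
    · by_cases hU' : P.ed e ⊆ U
      · exact Or.inl fun h => hUW.le_bot ⟨hU' hxe, h⟩
      by_cases hW' : P.ed e ⊆ W
      · exact absurd (hCU h0) (P.cl_disj hU hUW.symm hW' (P.z_mem_cl e))
      · refine Or.inr (mem_biUnion (show e ∈ J from ⟨⟨hU', hW'⟩, h0, h1⟩) (P.ed_sub_cl e hxe))
  rw [← closure_subset_iff_isClosed]
  intro x hx
  by_cases hxV : x ∈ P.V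
  · by_contra hns
    have hxC : x ∉ C := fun h => hns (Or.inl h)
    rcases closure_minimal hsub hcl hx with h | h
    · exact h (hCW ⟨hxV, hxC⟩)
    · simp only [mem_iUnion] at h
      obtain ⟨e, he, hxe⟩ := h
      rcases P.mem_cl hxe with h | h | h
      · exact P.ed_notV h hxV
      · exact hxC (h ▸ he.2.1)
      · exact hxC (h ▸ he.2.2)
  · obtain ⟨e, he⟩ := P.ed_cov hxV
    obtain ⟨y, hye, hy⟩ := mem_closure_iff.1 hx _ (P.op e) he
    rcases hy with hy | ⟨f, hf, h0, h1⟩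
    · exact absurd (hC.1 hy) (P.ed_notV hye)
    · rw [← P.ed_unique hye hf] at h0 h1
      exact Or.inr ⟨e, he, h0, h1⟩

theorem side_union (P : GPar X) (C : Set X) (x : X) :
    x ∈ P.side C ∨ x ∈ P.side (P.V \ C) ∨ ∃ e, P.Ct C e ∧ x ∈ P.ed e := by
  by_cases hxV : x ∈ P.V
  · by_cases hxC : x ∈ C
    · exact Or.inl (Or.inl hxC)
    · exact Or.inr (Or.inl (Or.inl ⟨hxV, hxC⟩))
  · obtain ⟨e, he⟩ := P.ed_cov hxV
    by_cases h0 : P.γ e 0 ∈ C <;> by_cases h1 : P.γ e 1 ∈ C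
    · exact Or.inl (Or.inr ⟨e, he, h0, h1⟩)
    · exact Or.inr (Or.inr ⟨e, Or.inl ⟨h0, h1⟩, he⟩)
    · exact Or.inr (Or.inr ⟨e, Or.inr ⟨h0, h1⟩, he⟩)
    · exact Or.inr (Or.inl (Or.inr ⟨e, he, ⟨P.z e, h0⟩, ⟨P.o e, h1⟩⟩))

theorem side_V (P : GPar X) {C : Set X} {x : X} (hxV : x ∈ P.V) : x ∈ P.side C ↔ x ∈ C := by
  constructor
  · rintro (h | ⟨e, he, _⟩)
    · exact h
    · exact absurd hxV (P.ed_notV he)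
  · exact Or.inl

theorem side_ed (P : GPar X) {C : Set X} (hC : C ⊆ P.V) {e : P.E} {x : X} (hx : x ∈ P.ed e) :
    x ∈ P.side C ↔ P.γ e 0 ∈ C ∧ P.γ e 1 ∈ C := by
  constructor
  · rintro (h | ⟨f, hf, h⟩)
    · exact absurd (hC h) (P.ed_notV hx)
    · rwa [P.ed_unique hx hf]
  · intro h; exact Or.inr ⟨e, hx, h⟩

theorem side_disj (P : GPar X) {C : Set X} (hC : C ⊆ P.V) {x : X} (h1 : x ∈ P.side C)
    (h2 : x ∈ P.side (P.V \ C)) : False := by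
  by_cases hxV : x ∈ P.V
  · rw [P.side_V hxV] at h1 h2; exact h2.2 h1
  · obtain ⟨e, he⟩ := P.ed_cov hxV
    rw [P.side_ed hC he] at h1
    rw [P.side_ed diff_subset he] at h2
    exact h2.1.2 h1.1

theorem ct_side (P : GPar X) {C : Set X} (hC : C ⊆ P.V) {e : P.E} (he : P.Ct C e) {x : X} (hx : x ∈ P.ed e) :
    x ∉ P.side C := by
  rw [P.side_ed hC hx]
  simp only [Ct, Crs] at he; tauto

theorem ct_ne (P : GPar X) {C : Set X} {e : P.E} (he : P.Ct C e) : P.γ e 0 ≠ P.γ e 1 := by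
  intro h
  simp only [Ct, Crs, h] at he; tauto

theorem injIcc (P : GPar X) {e : P.E} (he : P.γ e 0 ≠ P.γ e 1) : InjOn (P.γ e) (Icc 0 1) := by
  have key : ∀ a ∈ Icc (0:ℝ) 1, a = 0 ∨ a = 1 ∨ a ∈ Ioo (0:ℝ) 1 := by
    intro a ha
    rcases eq_or_lt_of_le ha.1 with h0 | h0
    · exact Or.inl h0.symm
    rcases eq_or_lt_of_le ha.2 with h1 | h1
    · exact Or.inr (Or.inl h1)
    · exact Or.inr (Or.inr ⟨h0, h1⟩)
  have hz := P.z e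
  have ho := P.o e
  intro a ha b hb hab
  rcases key a ha with rfl | rfl | ha' <;> rcases key b hb with rfl | rfl | hb'
  · rfl
  · exact absurd hab he
  · exact absurd (hab ▸ hz) (P.sub e b hb')
  · exact absurd hab.symm he
  · rfl
  · exact absurd (hab ▸ ho) (P.sub e b hb')
  · exact absurd (hab ▸ hz) (P.sub e a ha')
  · exact absurd (hab ▸ ho) (P.sub e a ha')
  · exact P.inj e ha' hb' hab

theorem halves [T2Space X] (P : GPar X) {C : Set X} {e : P.E} (he : P.Ct C e) {y : X}
    (hy : y ∈ P.ed e) : ∃ H0 H1 : Set X, IsClosed H0 ∧ IsClosed H1 ∧ H0 ∪ H1 = P.cl e ∧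
      H0 ∩ H1 ⊆ {y} ∧ H0 ∩ P.V ⊆ C ∧ H1 ∩ P.V ⊆ P.V \ C := by
  have hinj := P.injIcc (P.ct_ne he)
  obtain ⟨r, hr, rfl⟩ := hy
  have s0 : Icc 0 r ⊆ Icc 0 1 := Icc_subset_Icc_right hr.2.le
  have s1 : Icc r 1 ⊆ Icc 0 1 := Icc_subset_Icc_left hr.1.le
  have c0 : IsClosed (P.γ e '' Icc 0 r) :=
    (isCompact_Icc.image_of_continuousOn ((P.cont e).mono s0)).isClosed
  have c1 : IsClosed (P.γ e '' Icc r 1) :=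
    (isCompact_Icc.image_of_continuousOn ((P.cont e).mono s1)).isClosed
  have hun : P.γ e '' Icc 0 r ∪ P.γ e '' Icc r 1 = P.cl e := by
    rw [← image_union, Icc_union_Icc_eq_Icc hr.1.le hr.2.le]; rfl
  have hint : P.γ e '' Icc 0 r ∩ P.γ e '' Icc r 1 ⊆ {P.γ e r} := by
    rintro _ ⟨⟨a, ha, rfl⟩, ⟨b, hb, hab⟩⟩
    have := hinj (s1 hb) (s0 ha) hab
    subst this
    have : b = r := le_antisymm ha.2 hb.1
    rw [this]; rfl
  have v0 : ∀ x ∈ P.γ e '' Icc 0 r ∩ P.V, x = P.γ e 0 := by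
    rintro _ ⟨⟨a, ha, rfl⟩, hV⟩
    rcases eq_or_lt_of_le ha.1 with h0 | h0
    · rw [h0]
    · exact absurd hV (P.sub e a ⟨h0, ha.2.trans_lt hr.2⟩)
  have v1 : ∀ x ∈ P.γ e '' Icc r 1 ∩ P.V, x = P.γ e 1 := by
    rintro _ ⟨⟨a, ha, rfl⟩, hV⟩
    rcases eq_or_lt_of_le ha.2 with h0 | h0
    · rw [h0]
    · exact absurd hV (P.sub e a ⟨hr.1.trans_le ha.1, h0⟩)
  rcases he with ⟨h0, h1⟩ | ⟨h0, h1⟩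
  · exact ⟨_, _, c0, c1, hun, hint, fun x hx => v0 x hx ▸ h0,
      fun x hx => ⟨hx.2, v1 x hx ▸ h1⟩⟩
  · exact ⟨_, _, c1, c0, by rw [union_comm]; exact hun, by rw [inter_comm]; exact hint,
      fun x hx => v1 x hx ▸ h1, fun x hx => ⟨hx.2, v0 x hx ▸ h0⟩⟩

theorem cross [CompactSpace X] [T2Space X] (P : GPar X) {C : Set X} (hC : P.Clo C) {D : Set X}
    (hD : IsPreconnected D) (h0 : (D ∩ C).Nonempty) (h1 : (D ∩ (P.V \ C)).Nonempty) :
    ∃ e, P.Ct C e ∧ P.ed e ⊆ D := by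
  by_contra hcon
  push Not at hcon
  have hy : ∀ e : {e // P.Ct C e}, ∃ y ∈ P.ed e, y ∉ D := fun e => by
    have := hcon e e.2
    rw [not_subset] at this; exact this
  choose y hye hyD using hy
  choose H0 H1 c0 c1 hun hint v0 v1 using fun e : {e // P.Ct C e} => P.halves e.2 (hye e)
  haveI : Finite {e // P.Ct C e} := (P.cut_finite hC).to_subtype
  have cl0 : IsClosed (P.side C ∪ ⋃ e, H0 e) := (P.side_closed hC).union (isClosed_iUnion_of_finite c0)
  have cl1 : IsClosed (P.side (P.V \ C) ∪ ⋃ e, H1 e) :=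
    (P.side_closed hC.compl).union (isClosed_iUnion_of_finite c1)
  obtain ⟨a, haD, haC⟩ := h0
  obtain ⟨b, hbD, hbC⟩ := h1
  obtain ⟨x, hxD, hx0, hx1⟩ := isPreconnected_closed_iff.1 hD _ _ cl0 cl1 (by
    intro x _
    rcases P.side_union C x with h | h | ⟨e, he, hxe⟩
    · exact Or.inl (Or.inl h)
    · exact Or.inr (Or.inl h)
    · have : x ∈ H0 ⟨e, he⟩ ∪ H1 ⟨e, he⟩ := by rw [hun]; exact P.ed_sub_cl e hxe
      rcases this with h | h
      · exact Or.inl (Or.inr (mem_iUnion.2 ⟨_, h⟩))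
      · exact Or.inr (Or.inr (mem_iUnion.2 ⟨_, h⟩)))
    ⟨a, haD, Or.inl (Or.inl haC)⟩ ⟨b, hbD, Or.inl (Or.inl hbC)⟩
  have ined : ∀ e : {e // P.Ct C e}, x ∈ P.cl e → x ∉ P.V → x ∈ P.ed e := by
    intro e h hV
    rcases P.mem_cl h with h | h | h
    · exact h
    · exact absurd (h ▸ P.z e) hV
    · exact absurd (h ▸ P.o e) hV
  have s0 : ∀ e, x ∈ H0 e → x ∈ P.cl e := fun e h => by rw [← hun]; exact Or.inl h
  have s1 : ∀ e, x ∈ H1 e → x ∈ P.cl e := fun e h => by rw [← hun]; exact Or.inr h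
  simp only [mem_union, mem_iUnion] at hx0 hx1
  by_cases hV : x ∈ P.V
  · have hxC : x ∈ C := by
      rcases hx0 with h | ⟨e, h⟩
      · exact (P.side_V hV).1 h
      · exact v0 e ⟨h, hV⟩
    have hxC' : x ∈ P.V \ C := by
      rcases hx1 with h | ⟨e, h⟩
      · exact (P.side_V hV).1 h
      · exact v1 e ⟨h, hV⟩
    exact hxC'.2 hxC
  · rcases hx0 with h | ⟨e, h⟩
    · rcases hx1 with h' | ⟨f, h'⟩
      · exact P.side_disj hC.1 h h'
      · exact P.ct_side hC.1 f.2 (ined f (s1 f h') hV) h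
    · rcases hx1 with h' | ⟨f, h'⟩
      · exact P.ct_side diff_subset ((P.ct_compl C e).2 e.2) (ined e (s0 e h) hV) h'
      · have : e = f := Subtype.ext (P.ed_unique (ined e (s0 e h) hV) (ined f (s1 f h') hV))
        subst this
        have := hint e ⟨h, h'⟩
        rw [mem_singleton_iff] at this
        exact hyD e (this ▸ hxD)

end GPar

namespace GPar

/-- separating clopen vertex sets -/
def Sep (P : GPar X) (A B S : Set X) : Prop := P.Clo S ∧ A ⊆ S ∧ B ⊆ P.V \ S

theorem clo_pull (P : GPar X) {ι : Type*} (C : ι → Set X) (s : Finset ι) (hC : ∀ i ∈ s, P.Clo (C i))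
    (U : Set (Set ι)) : IsClosed {v | v ∈ P.V ∧ {i | i ∈ s ∧ v ∈ C i} ∈ U} := by
  have hfin : {w : Set ι | w ⊆ (s : Set ι) ∧ w ∈ U}.Finite :=
    s.finite_toSet.finite_subsets.subset fun w hw => hw.1
  have hat : ∀ w : Set ι, w ⊆ (s : Set ι) → IsClosed {v | v ∈ P.V ∧ {i | i ∈ s ∧ v ∈ C i} = w} := by
    intro w hw
    have : {v | v ∈ P.V ∧ {i | i ∈ s ∧ v ∈ C i} = w} =
        P.V ∩ ((⋂ i ∈ w, C i) ∩ ⋂ i ∈ (s : Set ι) \ w, P.V \ C i) := by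
      ext v
      constructor
      · rintro ⟨hv, rfl⟩
        refine ⟨hv, ?_, ?_⟩
        · simp only [mem_iInter]; exact fun i hi => hi.2
        · simp only [mem_iInter]
          exact fun i hi => ⟨hv, fun h => hi.2 ⟨hi.1, h⟩⟩
      · rintro ⟨hv, h1, h2⟩
        simp only [mem_iInter] at h1 h2
        refine ⟨hv, ?_⟩
        ext i
        constructor
        · rintro ⟨his, hi⟩
          by_contra hw'
          exact (h2 i ⟨his, hw'⟩).2 hi
        · intro hi; exact ⟨hw hi, h1 i hi⟩
    rw [this]
    refine P.closedV.inter ((isClosed_biInter fun i hi => (hC i (hw hi)).2.1).inter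
      (isClosed_biInter fun i hi => (hC i hi.1).2.2))
  have : {v | v ∈ P.V ∧ {i | i ∈ s ∧ v ∈ C i} ∈ U} =
      ⋃ w ∈ {w : Set ι | w ⊆ (s : Set ι) ∧ w ∈ U}, {v | v ∈ P.V ∧ {i | i ∈ s ∧ v ∈ C i} = w} := by
    ext v
    simp only [mem_iUnion]
    constructor
    · rintro ⟨hv, h⟩
      exact ⟨_, ⟨fun i hi => hi.1, h⟩, hv, rfl⟩
    · rintro ⟨w, ⟨_, hw⟩, hv, h⟩
      exact ⟨hv, by rw [h]; exact hw⟩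
  rw [this]
  exact hfin.isClosed_biUnion fun w hw => hat w hw.1

theorem colouring [CompactSpace X] [T2Space X] (P : GPar X) {A B : Set X} (hAV : A ⊆ P.V)
    (hBV : B ⊆ P.V) (k : ℕ)
    (h : ∀ S, P.Sep A B S → k ≤ {e | P.Ct S e}.ncard) :
    ∃ c : P.E → Fin (k+1), ∀ S, P.Sep A B S → ∀ i : ℕ, i < k → ∃ e, P.Ct S e ∧ (c e : ℕ) = i := by
  classical
  let ι := {S // P.Sep A B S}
  let t : ι → Set (P.E → Fin (k+1)) := fun S =>
    {c | ∀ i : ℕ, i < k → ∃ e, P.Ct S.1 e ∧ (c e : ℕ) = i}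
  have htc : ∀ S, IsClosed (t S) := by
    intro S
    have : t S = ⋂ i : ℕ, ⋂ _ : i < k, ⋃ e ∈ {e | P.Ct S.1 e}, {c | (c e : ℕ) = i} := by
      ext c
      simp only [t, mem_iInter, mem_iUnion, Set.mem_ofPred_eq, exists_prop]
    rw [this]
    refine isClosed_iInter fun i => isClosed_iInter fun _ =>
      (P.cut_finite S.2.1).isClosed_biUnion fun e _ => ?_
    exact (isClosed_discrete {x : Fin (k+1) | (x : ℕ) = i}).preimage
      (continuous_apply (A := fun _ : P.E => Fin (k+1)) e)
  have hst : ∀ s : Finset ι, (⋂ i ∈ s, t i).Nonempty := by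
    intro s
    let φ : X → Set ι := fun v => {i | i ∈ s ∧ v ∈ i.1}
    have hEf : (⋃ i ∈ (s : Set ι), {e | P.Ct i.1 e}).Finite :=
      s.finite_toSet.biUnion fun i _ => P.cut_finite i.2.1
    obtain ⟨c, hc⟩ := fmenger (W := Set ι) (s : Set ι) ∅ (hEf.toFinset.card + 1) hEf.toFinset
      (Nat.lt_succ_self _) (fun e => φ (P.γ e 0)) (fun e => φ (P.γ e 1)) k (by
        intro U hs ht
        let T : Set X := {v | v ∈ P.V ∧ φ v ∈ U}
        have hT : P.Sep A B T := by
          refine ⟨⟨fun v hv => hv.1, P.clo_pull (fun i : ι => i.1) s (fun i _ => i.2.1) U, ?_⟩, ?_, ?_⟩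
          · have : P.V \ T = {v | v ∈ P.V ∧ φ v ∈ Uᶜ} := by
              ext v; simp only [T, mem_diff, Set.mem_ofPred_eq, mem_compl_iff]; tauto
            rw [this]
            exact P.clo_pull (fun i : ι => i.1) s (fun i _ => i.2.1) Uᶜ
          · intro a ha
            refine ⟨hAV ha, ?_⟩
            have : φ a = (s : Set ι) := by
              ext i
              exact ⟨fun h => h.1, fun h => ⟨h, i.2.2.1 ha⟩⟩
            rw [this]; exact hs
          · intro b hb
            refine ⟨hBV hb, fun h => ht ?_⟩
            have : φ b = ∅ := by
              ext i
              exact ⟨fun h => (i.2.2.2 hb).2 h.2, fun h => h.elim⟩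
            rw [← this]; exact h.2
        refine (h T hT).trans ?_
        rw [← Set.ncard_coe_finset]
        refine Set.ncard_le_ncard ?_ (Finset.finite_toSet _)
        intro e he
        have hCr : Crs U (fun e => φ (P.γ e 0)) (fun e => φ (P.γ e 1)) e := by
          have h0 := P.z e
          have h1 := P.o e
          simp only [Set.mem_ofPred_eq, Ct, Crs, T] at he
          simp only [Crs]; tauto
        simp only [Finset.coe_filter, Set.mem_ofPred_eq]
        refine ⟨?_, hCr⟩
        have hne : φ (P.γ e 0) ≠ φ (P.γ e 1) := by
          intro hh
          simp only [Crs, hh] at hCr; tauto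
        rw [Finite.mem_toFinset]
        by_contra hcon
        simp only [mem_iUnion, not_exists] at hcon
        apply hne
        ext i
        by_cases hi : i ∈ s
        · have := hcon i hi
          simp only [Set.mem_ofPred_eq, Ct, Crs] at this
          simp only [φ, Set.mem_ofPred_eq]; tauto
        · simp only [φ, Set.mem_ofPred_eq]; tauto)
    refine ⟨fun e => if hh : c e < k then ⟨c e, by omega⟩ else ⟨k, by omega⟩, ?_⟩
    simp only [mem_iInter]
    intro S hS i hi
    obtain ⟨e, he, hCr, hce⟩ := hc {w | S ∈ w} hS (fun h => h) i hi
    refine ⟨e, ?_, by simp [hce, hi]⟩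
    simp only [Crs, φ, Set.mem_ofPred_eq, hS, true_and] at hCr
    exact hCr
  obtain ⟨c, hc⟩ := CompactSpace.iInter_nonempty htc hst
  refine ⟨c, fun S hS => ?_⟩
  exact mem_iInter.1 hc ⟨S, hS⟩

theorem exists_min [CompactSpace X] [T2Space X] (P : GPar X) {A B : Set X} (F0 : Set P.E)
    (h : ∀ S, P.Sep A B S → ∃ e ∈ F0, P.Ct S e) :
    ∃ F ⊆ F0, (∀ S, P.Sep A B S → ∃ e ∈ F, P.Ct S e) ∧
      ∀ e ∈ F, ∃ S, P.Sep A B S ∧ P.Ct S e ∧ ∀ f ∈ F, P.Ct S f → f = e := by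
  obtain ⟨F, hF, hmin⟩ := zorn_superset_nonempty {F : Set P.E | ∀ S, P.Sep A B S → ∃ e ∈ F, P.Ct S e}
    (by
      intro c hc hch hne
      refine ⟨⋂₀ c, ?_, fun s hs => sInter_subset_of_mem hs⟩
      intro S hS
      have hfin := P.cut_finite hS.1
      let N : Set ℕ := (fun F : Set P.E => (F ∩ {e | P.Ct S e}).ncard) '' c
      have hN : N.Nonempty := hne.image _
      obtain ⟨F, hFc, hFm⟩ := Nat.sInf_mem hN
      obtain ⟨e, heF, he⟩ := hc hFc S hS
      refine ⟨e, ?_, he⟩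
      intro F' hF'
      rcases hch.total hFc hF' with hh | hh
      · exact hh heF
      · have h1 : (F ∩ {e | P.Ct S e}).ncard ≤ (F' ∩ {e | P.Ct S e}).ncard := by
          have : (F ∩ {e | P.Ct S e}).ncard = sInf N := hFm
          rw [this]
          exact Nat.sInf_le ⟨F', hF', rfl⟩
        have := Set.eq_of_subset_of_ncard_le (inter_subset_inter_left {e | P.Ct S e} hh) h1
          (hfin.subset inter_subset_right)
        have h2 : e ∈ F ∩ {e | P.Ct S e} := ⟨heF, he⟩
        rw [← this] at h2
        exact h2.1) F0 h
  refine ⟨F, hF, hmin.prop, ?_⟩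
  intro e he
  by_contra hcon
  push Not at hcon
  have : F \ {e} ∈ {F : Set P.E | ∀ S, P.Sep A B S → ∃ e ∈ F, P.Ct S e} := by
    intro S hS
    obtain ⟨f, hf, hfS⟩ := hmin.prop S hS
    by_cases hfe : f = e
    · subst hfe
      obtain ⟨g, hg, hgS, hgf⟩ := hcon S hS hfS
      exact ⟨g, ⟨hg, hgf⟩, hgS⟩
    · exact ⟨f, ⟨hf, hfe⟩, hfS⟩
  exact (hmin.le_of_le this diff_subset he).2 rfl

end GPar

namespace GPar

/-- data of a minimal set of edges joining the two sides -/
structure Lin (P : GPar X) (A B : Set X) (F : Set P.E) (S : P.E → Set X) (K : Set X) : Prop where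
  closed : IsClosed K
  pre : IsPreconnected K
  sub : ∀ e ∈ F, P.ed e ⊆ K
  only : ∀ e x, x ∈ K → x ∈ P.ed e → e ∈ F
  sep : ∀ e ∈ F, P.Sep A B (S e)
  ct : ∀ e ∈ F, P.Ct (S e) e
  uniq : ∀ e ∈ F, ∀ f ∈ F, P.Ct (S e) f → f = e
  neA : (K ∩ A).Nonempty
  neB : (K ∩ B).Nonempty

theorem sep_mix (P : GPar X) {A B S1 S2 C : Set X} (hAV : A ⊆ P.V)
    (s1 : P.Sep A B S1) (s2 : P.Sep A B S2) (hC : P.Clo C) :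
    P.Sep A B ((S1 ∩ C) ∪ (S2 ∩ (P.V \ C))) := by
  refine ⟨⟨?_, ?_, ?_⟩, ?_, ?_⟩
  · rintro x (hx | hx)
    · exact hC.1 hx.2
    · exact hx.2.1
  · exact (s1.1.2.1.inter hC.2.1).union (s2.1.2.1.inter hC.2.2)
  · have : P.V \ ((S1 ∩ C) ∪ (S2 ∩ (P.V \ C))) =
        ((P.V \ S1) ∩ C) ∪ ((P.V \ S2) ∩ (P.V \ C)) := by
      ext x
      have := @hC.1 x
      simp only [Set.mem_sdiff, mem_union, mem_inter_iff]; tauto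
    rw [this]
    exact (s1.1.2.2.inter hC.2.1).union (s2.1.2.2.inter hC.2.2)
  · intro a ha
    by_cases haC : a ∈ C
    · exact Or.inl ⟨s1.2.1 ha, haC⟩
    · exact Or.inr ⟨s2.2.1 ha, hAV ha, haC⟩
  · intro b hb
    refine ⟨(s1.2.2 hb).1, ?_⟩
    rintro (h | h)
    · exact (s1.2.2 hb).2 h.1
    · exact (s2.2.2 hb).2 h.1

theorem exists_lin [CompactSpace X] [T2Space X] (P : GPar X) {A B : Set X} (hAV : A ⊆ P.V)
    (hBV : B ⊆ P.V) (hA : IsClosed A) (hB : IsClosed B) (hAB : Disjoint A B) (F0 : Set P.E)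
    (h : ∀ S, P.Sep A B S → ∃ e ∈ F0, P.Ct S e) :
    ∃ F ⊆ F0, ∃ S K, P.Lin A B F S K := by
  classical
  obtain ⟨F, hF0, hF, hmin⟩ := P.exists_min F0 h
  choose! S hS hct huniq using hmin
  set K := closure (⋃ e ∈ F, P.ed e) with hK
  have hKc : IsClosed K := isClosed_closure
  have hsub : ∀ e ∈ F, P.ed e ⊆ K := fun e he =>
    (subset_biUnion_of_mem (u := P.ed) he).trans subset_closure
  have hcl : ∀ e ∈ F, P.cl e ⊆ K := fun e he => by
    rw [← P.cl_eq]; exact closure_minimal (hsub e he) hKc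
  refine ⟨F, hF0, S, K, hKc, ?_, hsub, ?_, hS, hct, huniq, ?_, ?_⟩
  · rw [isPreconnected_closed_iff]
    intro Z1 Z2 c1 c2 hZ n1 n2
    by_contra hcon
    have hdis : ∀ x ∈ K, x ∈ Z1 → x ∈ Z2 → False := fun x hx h1 h2 => hcon ⟨x, hx, h1, h2⟩
    have hor : ∀ e ∈ F, P.ed e ⊆ Z1 ∨ P.ed e ⊆ Z2 := by
      intro e he
      by_contra hc
      push Not at hc
      obtain ⟨x, hx, hx1⟩ := not_subset.1 hc.1
      obtain ⟨y, hy, hy2⟩ := not_subset.1 hc.2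
      obtain ⟨w, hw, h1, h2⟩ := isPreconnected_closed_iff.1 (P.ed_pre e) Z1 Z2 c1 c2
        ((hsub e he).trans hZ) ⟨y, hy, (hZ (hsub e he hy)).resolve_right hy2⟩
        ⟨x, hx, (hZ (hsub e he hx)).resolve_left hx1⟩
      exact hdis w (hsub e he hw) h1 h2
    have hex : ∀ Z Z' : Set X, IsClosed Z → (K ∩ Z').Nonempty → (∀ x ∈ K, x ∈ Z → x ∈ Z' → False) →
        (∀ e ∈ F, P.ed e ⊆ Z ∨ P.ed e ⊆ Z') → ∃ e ∈ F, P.ed e ⊆ Z' := by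
      intro Z Z' hZ ⟨x, hxK, hx⟩ hd ho
      by_contra hc
      push Not at hc
      have : K ⊆ Z := closure_minimal (iUnion₂_subset fun e he => (ho e he).resolve_right (hc e he)) hZ
      exact hd x hxK (this hxK) hx
    obtain ⟨e2, he2, hz2⟩ := hex Z1 Z2 c1 n2 hdis hor
    obtain ⟨e1, he1, hz1⟩ := hex Z2 Z1 c2 n1 (fun x h a b => hdis x h b a) (fun e he => (hor e he).symm)
    obtain ⟨C, hCV, hC1, hC2, hC3, hC4⟩ := sepV (A := K ∩ Z1 ∩ P.V) (B := K ∩ Z2 ∩ P.V) P.closedV P.tdV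
      ((hKc.inter c1).inter P.closedV) ((hKc.inter c2).inter P.closedV) inter_subset_right
      (by rw [disjoint_left]; exact fun x h1 h2 => hdis x h1.1.1 h1.1.2 h2.1.2)
    have s1 := hS e2 he2
    have s2 := hS e1 he1
    have hT : P.Sep A B ((S e2 ∩ C) ∪ (S e1 ∩ (P.V \ C))) :=
      P.sep_mix hAV s1 s2 ⟨hCV, hC1, hC2⟩
    obtain ⟨e, he, hce⟩ := hF _ hT
    have hz := P.z e
    have ho := P.o e
    rcases hor e he with h1 | h1
    · have hclZ : P.cl e ⊆ Z1 := by rw [← P.cl_eq]; exact closure_minimal h1 c1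
      have hzC : P.γ e 0 ∈ C := hC3 ⟨⟨hcl e he (P.z_mem_cl e), hclZ (P.z_mem_cl e)⟩, hz⟩
      have hoC : P.γ e 1 ∈ C := hC3 ⟨⟨hcl e he (P.o_mem_cl e), hclZ (P.o_mem_cl e)⟩, ho⟩
      have : P.Ct (S e2) e := by
        simpa only [Ct, Crs, mem_union, mem_inter_iff, Set.mem_sdiff, hzC, hoC, hz, ho, and_true,
          not_true, and_false, or_false] using hce
      have := huniq e2 he2 e he this
      subst this
      obtain ⟨x, hx⟩ := P.ed_ne e
      exact hdis x (hsub e he hx) (h1 hx) (hz2 hx)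
    · have hclZ : P.cl e ⊆ Z2 := by rw [← P.cl_eq]; exact closure_minimal h1 c2
      have hzC : P.γ e 0 ∉ C := fun hh =>
        hC4.le_bot ⟨hh, ⟨hcl e he (P.z_mem_cl e), hclZ (P.z_mem_cl e)⟩, hz⟩
      have hoC : P.γ e 1 ∉ C := fun hh =>
        hC4.le_bot ⟨hh, ⟨hcl e he (P.o_mem_cl e), hclZ (P.o_mem_cl e)⟩, ho⟩
      have : P.Ct (S e1) e := by
        simpa only [Ct, Crs, mem_union, mem_inter_iff, Set.mem_sdiff, hzC, hoC, hz, ho, and_true,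
          not_false_eq_true, and_false, false_or] using hce
      have := huniq e1 he1 e he this
      subst this
      obtain ⟨x, hx⟩ := P.ed_ne e
      exact hdis x (hsub e he hx) (hz1 hx) (h1 hx)
  · intro e x hxK hxe
    obtain ⟨y, hye, hy⟩ := mem_closure_iff.1 hxK _ (P.op e) hxe
    simp only [mem_iUnion] at hy
    obtain ⟨f, hf, hyf⟩ := hy
    rw [P.ed_unique hye hyf]; exact hf
  · by_contra hcon
    obtain ⟨C, hCV, hC1, hC2, hC3, hC4⟩ := sepV (A := A) (B := B ∪ (K ∩ P.V)) P.closedV P.tdV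
      hA (hB.union (hKc.inter P.closedV)) hAV
      (by
        rw [disjoint_left]; rintro x h1 (h2 | h2)
        · exact hAB.le_bot ⟨h1, h2⟩
        · exact hcon ⟨x, h2.1, h1⟩)
    obtain ⟨e, he, hce⟩ := hF C ⟨⟨hCV, hC1, hC2⟩, hC3, fun b hb =>
      ⟨hBV hb, fun h => hC4.le_bot ⟨h, Or.inl hb⟩⟩⟩
    have k0 : P.γ e 0 ∉ C := fun h => hC4.le_bot ⟨h, Or.inr ⟨hcl e he (P.z_mem_cl e), P.z e⟩⟩
    have k1 : P.γ e 1 ∉ C := fun h => hC4.le_bot ⟨h, Or.inr ⟨hcl e he (P.o_mem_cl e), P.o e⟩⟩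
    simp [Ct, Crs, k0, k1] at hce
  · by_contra hcon
    obtain ⟨C, hCV, hC1, hC2, hC3, hC4⟩ := sepV (A := B) (B := A ∪ (K ∩ P.V)) P.closedV P.tdV
      hB (hA.union (hKc.inter P.closedV)) hBV
      (by
        rw [disjoint_left]; rintro x h1 (h2 | h2)
        · exact hAB.le_bot ⟨h2, h1⟩
        · exact hcon ⟨x, h2.1, h1⟩)
    have hcl0 : P.Clo C := ⟨hCV, hC1, hC2⟩
    obtain ⟨e, he, hce⟩ := hF (P.V \ C) ⟨hcl0.compl, fun a ha =>
      ⟨hAV ha, fun h => hC4.le_bot ⟨h, Or.inl ha⟩⟩, fun b hb => ⟨hBV hb, fun h => h.2 (hC3 hb)⟩⟩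
    rw [P.ct_compl] at hce
    have k0 : P.γ e 0 ∉ C := fun h => hC4.le_bot ⟨h, Or.inr ⟨hcl e he (P.z_mem_cl e), P.z e⟩⟩
    have k1 : P.γ e 1 ∉ C := fun h => hC4.le_bot ⟨h, Or.inr ⟨hcl e he (P.o_mem_cl e), P.o e⟩⟩
    simp [Ct, Crs, k0, k1] at hce

theorem ends (P : GPar X) {S : Set X} {e : P.E} (he : P.Ct S e) :
    ∃ p q, p ∈ P.cl e ∧ q ∈ P.cl e ∧ p ∈ S ∧ q ∈ P.V \ S ∧ ∀ x ∈ P.cl e, x ∈ P.ed e ∨ x = p ∨ x = q := by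
  rcases he with ⟨h0, h1⟩ | ⟨h0, h1⟩
  · exact ⟨_, _, P.z_mem_cl e, P.o_mem_cl e, h0, ⟨P.o e, h1⟩, fun x hx => P.mem_cl hx⟩
  · refine ⟨_, _, P.o_mem_cl e, P.z_mem_cl e, h1, ⟨P.z e, h0⟩, fun x hx => ?_⟩
    rcases P.mem_cl hx with h | h | h <;> tauto

theorem level [CompactSpace X] [T2Space X] (P : GPar X) {S D : Set X} {e : P.E} (hDc : IsClosed D)
    (hDp : IsPreconnected D) (hS : P.Clo S) (he : P.Ct S e)
    (hf : ∀ f x, x ∈ D → x ∈ P.ed f → P.Ct S f → f = e)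
    (h : P.ed e ⊆ D ∨ Disjoint (P.ed e) D) : IsPreconnected (D ∩ P.side S) := by
  have cS := P.side_closed hS
  have cS' := P.side_closed hS.compl
  rcases h with h | h
  · obtain ⟨p, q, hp, hq, hpS, hqS, hpq⟩ := P.ends he
    have hclD : P.cl e ⊆ D := by rw [← P.cl_eq]; exact closure_minimal h hDc
    have key : ∀ Z1 Z2, IsClosed Z1 → IsClosed Z2 → D ∩ P.side S ⊆ Z1 ∪ Z2 → p ∈ Z1 →
        ((D ∩ P.side S) ∩ Z2).Nonempty → ((D ∩ P.side S) ∩ (Z1 ∩ Z2)).Nonempty := by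
      intro Z1 Z2 c1 c2 hZ hpZ ⟨y, hyD, hyZ⟩
      obtain ⟨x, hxD, hx1, hx2⟩ := isPreconnected_closed_iff.1 hDp
        ((Z1 ∩ P.side S) ∪ P.cl e ∪ P.side (P.V \ S)) (Z2 ∩ P.side S)
        (((c1.inter cS).union (P.cl_closed e)).union cS') (c2.inter cS) (by
          intro x hx
          rcases P.side_union S x with h1 | h1 | ⟨f, h1, h2⟩
          · rcases hZ ⟨hx, h1⟩ with h2 | h2
            · exact Or.inl (Or.inl (Or.inl ⟨h2, h1⟩))
            · exact Or.inr ⟨h2, h1⟩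
          · exact Or.inl (Or.inr h1)
          · have := hf f x hx h2 h1
            subst this
            exact Or.inl (Or.inl (Or.inr (P.ed_sub_cl _ h2))))
        ⟨p, hclD hp, Or.inl (Or.inr hp)⟩ ⟨y, hyD.1, hyZ, hyD.2⟩
      rcases hx1 with (hx1 | hx1) | hx1
      · exact ⟨x, ⟨hxD, hx2.2⟩, hx1.1, hx2.1⟩
      · rcases hpq x hx1 with h1 | h1 | h1
        · exact absurd hx2.2 (P.ct_side hS.1 he h1)
        · subst h1
          exact ⟨x, ⟨hxD, hx2.2⟩, hpZ, hx2.1⟩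
        · subst h1
          exact absurd ((P.side_V hqS.1).1 hx2.2) hqS.2
      · exact (P.side_disj hS.1 hx2.2 hx1).elim
    rw [isPreconnected_closed_iff]
    intro Z1 Z2 c1 c2 hZ n1 n2
    rcases hZ ⟨hclD hp, Or.inl hpS⟩ with h1 | h1
    · exact key Z1 Z2 c1 c2 hZ h1 n2
    · rw [inter_comm Z1]
      exact key Z2 Z1 c2 c1 (by rw [union_comm]; exact hZ) h1 n1
  · by_cases hne : (D ∩ P.side S).Nonempty
    · have : D ⊆ P.side S := by
        intro x hx
        by_contra hxS
        have hcov : D ⊆ P.side S ∪ P.side (P.V \ S) := by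
          intro y hy
          rcases P.side_union S y with h1 | h1 | ⟨f, h1, h2⟩
          · exact Or.inl h1
          · exact Or.inr h1
          · have := hf f y hy h2 h1
            subst this
            exact (h.le_bot ⟨h2, hy⟩).elim
        obtain ⟨y, hy, h1, h2⟩ := isPreconnected_closed_iff.1 hDp _ _ cS cS' hcov hne
          ⟨x, hx, (hcov hx).resolve_left hxS⟩
        exact P.side_disj hS.1 h1 h2
      rwa [inter_eq_left.2 this]
    · rw [not_nonempty_iff_eq_empty.1 hne]; exact isPreconnected_empty

theorem coord [T2Space X] (P : GPar X) {S : Set X} (hSV : S ⊆ P.V) {e : P.E} (he : P.Ct S e) :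
    ∃ τ : X → ℝ, ContinuousOn τ (P.cl e) ∧ InjOn τ (P.cl e) ∧ (∀ x ∈ P.ed e, τ x ∈ Ioo (0:ℝ) 1) ∧
      ∀ x ∈ P.cl e, (x ∈ S → τ x = 0) ∧ (x ∈ P.V \ S → τ x = 1) := by
  have hinj := P.injIcc (P.ct_ne he)
  let σ := invFunOn (P.γ e) (Icc 0 1)
  have hσ : ∀ r ∈ Icc (0:ℝ) 1, σ (P.γ e r) = r := fun r hr => hinj.leftInvOn_invFunOn hr
  have hσc : ContinuousOn σ (P.cl e) := by
    rw [continuousOn_iff_isClosed]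
    intro t ht
    refine ⟨P.γ e '' (Icc 0 1 ∩ t), ((isCompact_Icc.inter_right ht).image_of_continuousOn
      ((P.cont e).mono inter_subset_left)).isClosed, ?_⟩
    ext x
    constructor
    · rintro ⟨h1, r, hr, rfl⟩
      refine ⟨⟨r, ⟨hr, ?_⟩, rfl⟩, r, hr, rfl⟩
      rwa [mem_preimage, hσ r hr] at h1
    · rintro ⟨⟨r, ⟨hr, hrt⟩, rfl⟩, h⟩
      refine ⟨?_, h⟩
      rw [mem_preimage, hσ r hr]; exact hrt
  have hσi : InjOn σ (P.cl e) := by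
    rintro _ ⟨r, hr, rfl⟩ _ ⟨s, hs, rfl⟩ h
    rw [hσ r hr, hσ s hs] at h; rw [h]
  have hσe : ∀ x ∈ P.ed e, σ x ∈ Ioo (0:ℝ) 1 := by
    rintro _ ⟨r, hr, rfl⟩
    rw [hσ r (Ioo_subset_Icc_self hr)]; exact hr
  have e0 := hσ 0 (by simp)
  have e1 := hσ 1 (by simp)
  rcases he with ⟨h0, h1⟩ | ⟨h0, h1⟩
  · refine ⟨σ, hσc, hσi, hσe, fun x hx => ?_⟩
    rcases P.mem_cl hx with h | h | h
    · exact ⟨fun hxS => absurd (hSV hxS) (P.ed_notV h), fun hxS => absurd hxS.1 (P.ed_notV h)⟩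
    · subst h; exact ⟨fun _ => e0, fun h => absurd h0 h.2⟩
    · subst h; exact ⟨fun h => absurd h h1, fun _ => e1⟩
  · refine ⟨fun x => 1 - σ x, continuousOn_const.sub hσc, fun x hx y hy h => hσi hx hy (by simpa using h),
      fun x hx => ?_, fun x hx => ?_⟩
    · have := hσe x hx
      exact ⟨by linarith [this.2], by linarith [this.1]⟩
    rcases P.mem_cl hx with h | h | h
    · exact ⟨fun hxS => absurd (hSV hxS) (P.ed_notV h), fun hxS => absurd hxS.1 (P.ed_notV h)⟩
    · subst h; exact ⟨fun h => absurd h h0, fun _ => by simp [e0]⟩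
    · subst h; exact ⟨fun _ => by simp [e1], fun h => absurd h1 h.2⟩

end GPar

namespace GPar

theorem Lin.tri {P : GPar X} {A B : Set X} {F : Set P.E} {S : P.E → Set X} {K : Set X}
    (L : P.Lin A B F S K) {e : P.E} (he : e ∈ F) {x : X} (hx : x ∈ K) :
    x ∈ P.side (S e) ∨ x ∈ P.side (P.V \ S e) ∨ x ∈ P.ed e := by
  rcases P.side_union (S e) x with h | h | ⟨f, h1, h2⟩
  · tauto
  · tauto
  · have := L.uniq e he f (L.only f x hx h2) h1
    subst this; tauto

theorem Lin.exists_g [CompactSpace X] [T2Space X] {P : GPar X} {A B : Set X} {F : Set P.E}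
    {S : P.E → Set X} {K : Set X} (L : P.Lin A B F S K) {e : P.E} (he : e ∈ F) :
    ∃ g : X → ℝ, ContinuousOn g K ∧ (∀ x ∈ P.side (S e), g x = 0) ∧
      (∀ x ∈ P.side (P.V \ S e), g x = 1) ∧ (∀ x ∈ P.ed e, g x ∈ Ioo (0:ℝ) 1) ∧
      InjOn g (P.ed e) := by
  classical
  have hS := (L.sep e he).1
  have hct := L.ct e he
  obtain ⟨τ, hτc, hτi, hτe, hτ⟩ := P.coord hS.1 hct
  let g : X → ℝ := fun x => if x ∈ P.side (S e) then 0 else if x ∈ P.side (P.V \ S e) then 1 else τ x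
  have g0 : ∀ x ∈ P.side (S e), g x = 0 := fun x hx => if_pos hx
  have g1 : ∀ x ∈ P.side (P.V \ S e), g x = 1 := fun x hx => by
    have : x ∉ P.side (S e) := fun h => P.side_disj hS.1 h hx
    simp only [g, if_neg this, if_pos hx]
  have ge : ∀ x ∈ P.ed e, g x = τ x := fun x hx => by
    have h1 : x ∉ P.side (S e) := P.ct_side hS.1 hct hx
    have h2 : x ∉ P.side (P.V \ S e) := P.ct_side hS.compl.1 ((P.ct_compl _ e).2 hct) hx
    simp only [g, if_neg h1, if_neg h2]
  have gcl : ∀ x ∈ P.cl e, g x = τ x := by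
    intro x hx
    by_cases hxV : x ∈ P.V
    · by_cases hxS : x ∈ S e
      · rw [g0 x (Or.inl hxS), (hτ x hx).1 hxS]
      · rw [g1 x (Or.inl ⟨hxV, hxS⟩), (hτ x hx).2 ⟨hxV, hxS⟩]
    · rcases P.mem_cl hx with h | h | h
      · exact ge x h
      · exact absurd (h ▸ P.z e) hxV
      · exact absurd (h ▸ P.o e) hxV
  refine ⟨g, ?_, g0, g1, fun x hx => by rw [ge x hx]; exact hτe x hx, fun x hx y hy h => ?_⟩
  · have c0 : ContinuousOn g (P.side (S e)) := continuousOn_const.congr g0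
    have c1 : ContinuousOn g (P.side (P.V \ S e)) := continuousOn_const.congr g1
    have c2 : ContinuousOn g (P.cl e) := hτc.congr gcl
    refine ((c0.union_of_isClosed c1 (P.side_closed hS) (P.side_closed hS.compl)).union_of_isClosed c2
      ((P.side_closed hS).union (P.side_closed hS.compl)) (P.cl_closed e)).mono ?_
    intro x hx
    rcases L.tri he hx with h | h | h
    · exact Or.inl (Or.inl h)
    · exact Or.inl (Or.inr h)
    · exact Or.inr (P.ed_sub_cl e h)
  · rw [ge x hx, ge y hy] at h
    exact hτi (P.ed_sub_cl e hx) (P.ed_sub_cl e hy) h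

theorem Lin.atom [CompactSpace X] [T2Space X] {P : GPar X} {A B : Set X} {F : Set P.E}
    {S : P.E → Set X} {K : Set X} (L : P.Lin A B F S K) {x y : X} (hx : x ∈ K) (hy : y ∈ K)
    (hxV : x ∈ P.V) (hyV : y ∈ P.V)
    (hxy : ∀ e ∈ F, x ∈ S e ↔ y ∈ S e) {J : Set P.E} (hJ : J.Finite) (hJF : J ⊆ F) :
    ∃ D ⊆ K, IsClosed D ∧ IsPreconnected D ∧ x ∈ D ∧ y ∈ D ∧
      (∀ f, P.ed f ⊆ D ∨ Disjoint (P.ed f) D) ∧ ∀ f ∈ J, Disjoint (P.ed f) D := by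
  induction J, hJ using Set.Finite.induction_on with
  | empty =>
    refine ⟨K, Subset.rfl, L.closed, L.pre, hx, hy, fun f => ?_, fun f hf => hf.elim⟩
    by_cases hf : f ∈ F
    · exact Or.inl (L.sub f hf)
    · right
      rw [disjoint_left]
      exact fun z hz hzK => hf (L.only f z hzK hz)
  | @insert e J _ _ ih =>
    obtain ⟨D, hDK, hDc, hDp, hxD, hyD, hdi, hJd⟩ := ih ((subset_insert _ _).trans hJF)
    have he : e ∈ F := hJF (mem_insert _ _)
    have key : ∀ T, P.Clo T → P.Ct T e → (∀ f ∈ F, P.Ct T f → f = e) → x ∈ T → y ∈ T →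
      ∃ D ⊆ K, IsClosed D ∧ IsPreconnected D ∧ x ∈ D ∧ y ∈ D ∧
      (∀ f, P.ed f ⊆ D ∨ Disjoint (P.ed f) D) ∧ ∀ f ∈ insert e J, Disjoint (P.ed f) D := by
      intro T hT hTe hTu hxT hyT
      refine ⟨D ∩ P.side T, inter_subset_left.trans hDK, hDc.inter (P.side_closed hT), ?_,
        ⟨hxD, Or.inl hxT⟩, ⟨hyD, Or.inl hyT⟩, ?_, ?_⟩
      · exact P.level hDc hDp hT hTe (fun f z hz hzf hf => hTu f (L.only f z (hDK hz) hzf) hf) (hdi e)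
      · intro f
        rcases hdi f with h | h
        · by_cases hh : P.γ f 0 ∈ T ∧ P.γ f 1 ∈ T
          · exact Or.inl fun z hz => ⟨h hz, (P.side_ed hT.1 hz).2 hh⟩
          · right
            rw [disjoint_left]
            exact fun z hz hzK => hh ((P.side_ed hT.1 hz).1 hzK.2)
        · exact Or.inr (h.mono_right inter_subset_left)
      · rintro f (rfl | hf)
        · rw [disjoint_left]
          exact fun z hz hzK => P.ct_side hT.1 hTe hz hzK.2
        · exact (hJd f hf).mono_right inter_subset_left
    have hS := (L.sep e he).1
    by_cases hxS : x ∈ S e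
    · exact key (S e) hS (L.ct e he) (L.uniq e he) hxS ((hxy e he).1 hxS)
    · refine key (P.V \ S e) hS.compl ((P.ct_compl _ _).2 (L.ct e he))
        (fun f hf h => L.uniq e he f hf ((P.ct_compl _ _).1 h)) ⟨hxV, hxS⟩
        ⟨hyV, fun h => hxS ((hxy e he).2 h)⟩

theorem Lin.separates [CompactSpace X] [T2Space X] {P : GPar X} {A B : Set X} {F : Set P.E}
    {S : P.E → Set X} {K : Set X} (L : P.Lin A B F S K) {x y : X} (hx : x ∈ K) (hy : y ∈ K)
    (hxV : x ∈ P.V) (hyV : y ∈ P.V)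
    (hxy : ∀ e ∈ F, x ∈ S e ↔ y ∈ S e) : x = y := by
  by_contra hne
  obtain ⟨C, hCV, hC1, hC2, hC3, hC4⟩ := sepV (A := {x}) (B := {y}) P.closedV P.tdV
    isClosed_singleton isClosed_singleton (by simpa using hxV) (by simpa using hne)
  have hC : P.Clo C := ⟨hCV, hC1, hC2⟩
  obtain ⟨D, hDK, hDc, hDp, hxD, hyD, hdi, hJd⟩ := L.atom hx hy hxV hyV hxy
    (J := F ∩ {e | P.Ct C e}) ((P.cut_finite hC).subset inter_subset_right) inter_subset_left
  obtain ⟨f, hf, hfD⟩ := P.cross hC hDp ⟨x, hxD, hC3 rfl⟩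
    ⟨y, hyD, hyV, fun h => hC4.le_bot ⟨h, rfl⟩⟩
  obtain ⟨z, hz⟩ := P.ed_ne f
  exact (hJd f ⟨L.only f z (hDK (hfD hz)) hz, hf⟩).le_bot ⟨hz, hfD hz⟩

theorem coh_aux [CompactSpace X] [T2Space X] (P : GPar X) {K S1 S2 : Set X} {e f : P.E} {c : X}
    (hKc : IsClosed K) (hKp : IsPreconnected K) (hS1 : P.Clo S1) (hS2 : P.Clo S2)
    (he : P.Ct S1 e) (he2 : ¬ P.Ct S2 e)
    (u1 : ∀ f x, x ∈ K → x ∈ P.ed f → P.Ct S1 f → f = e)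
    (u2 : ∀ g x, x ∈ K → x ∈ P.ed g → P.Ct S2 g → g = f)
    (hcK : c ∈ K) (hc1 : c ∈ S1) (hc2 : c ∈ S2) (heK : P.ed e ⊆ K)
    (hf : P.γ f 0 ∉ S1) : ∀ x ∈ K, x ∉ P.side (P.V \ S1) → x ∈ P.side S2 := by
  have hD := P.level hKc hKp hS1 he u1 (Or.inl heK)
  have hDS : K ∩ P.side S1 ⊆ P.side S2 := by
    have hcov : K ∩ P.side S1 ⊆ P.side S2 ∪ P.side (P.V \ S2) := by
      rintro y ⟨hyK, hy⟩
      rcases P.side_union S2 y with h | h | ⟨g, h1, h2⟩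
      · exact Or.inl h
      · exact Or.inr h
      · have := u2 g y hyK h2 h1
        subst this
        exact absurd ((P.side_ed hS1.1 h2).1 hy).1 hf
    intro x hx
    by_contra hxS
    obtain ⟨y, hy, h1, h2⟩ := isPreconnected_closed_iff.1 hD _ _ (P.side_closed hS2)
      (P.side_closed hS2.compl) hcov ⟨c, ⟨hcK, Or.inl hc1⟩, Or.inl hc2⟩
      ⟨x, hx, (hcov hx).resolve_left hxS⟩
    exact P.side_disj hS2.1 h1 h2
  have hclK : P.cl e ⊆ K := by rw [← P.cl_eq]; exact closure_minimal heK hKc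
  intro x hx hxn
  rcases P.side_union S1 x with h | h | ⟨g, h1, h2⟩
  · exact hDS ⟨hx, h⟩
  · exact absurd h hxn
  · have := u1 g x hx h2 h1
    subst this
    rw [P.side_ed hS2.1 h2]
    have hz := P.z g
    have ho := P.o g
    rcases he with ⟨k0, k1⟩ | ⟨k0, k1⟩
    · have : P.γ g 0 ∈ S2 := (P.side_V hz).1 (hDS ⟨hclK (P.z_mem_cl g), Or.inl k0⟩)
      simp only [Ct, Crs] at he2; tauto
    · have : P.γ g 1 ∈ S2 := (P.side_V ho).1 (hDS ⟨hclK (P.o_mem_cl g), Or.inl k1⟩)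
      simp only [Ct, Crs] at he2; tauto

theorem Lin.coh [CompactSpace X] [T2Space X] {P : GPar X} {A B : Set X} {F : Set P.E}
    {S : P.E → Set X} {K : Set X} (L : P.Lin A B F S K) {e f : P.E} (he : e ∈ F) (hf : f ∈ F)
    (hef : e ≠ f) :
    (∀ x ∈ K, x ∉ P.side (P.V \ S e) → x ∈ P.side (S f)) ∨
    (∀ x ∈ K, x ∉ P.side (S e) → x ∈ P.side (P.V \ S f)) := by
  have s1 := L.sep e he
  have s2 := L.sep f hf
  have n1 : ¬ P.Ct (S f) e := fun h => hef (L.uniq f hf e he h)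
  by_cases h : P.γ f 0 ∈ S e
  · right
    obtain ⟨b, hbK, hb⟩ := L.neB
    have := P.coh_aux (S1 := P.V \ S e) (S2 := P.V \ S f) (e := e) (f := f) (c := b) L.closed L.pre
      s1.1.compl s2.1.compl ((P.ct_compl _ _).2 (L.ct e he)) (fun h => n1 ((P.ct_compl _ _).1 h))
      (fun g x hx hg hc => L.uniq e he g (L.only g x hx hg) ((P.ct_compl _ _).1 hc))
      (fun g x hx hg hc => L.uniq f hf g (L.only g x hx hg) ((P.ct_compl _ _).1 hc))
      hbK (s1.2.2 hb) (s2.2.2 hb) (L.sub e he) (fun hh => hh.2 h)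
    rwa [sdiff_sdiff_cancel_left s1.1.1] at this
  · left
    obtain ⟨a, haK, ha⟩ := L.neA
    exact P.coh_aux (e := e) (f := f) (c := a) L.closed L.pre
      s1.1 s2.1 (L.ct e he) n1
      (fun g x hx hg hc => L.uniq e he g (L.only g x hx hg) hc)
      (fun g x hx hg hc => L.uniq f hf g (L.only g x hx hg) hc)
      haK (s1.2.1 ha) (s2.2.1 ha) (L.sub e he) h

theorem inv_cont [T2Space X] {K : Set X} {g : X → ℝ} (hK : IsCompact K) (hg : ContinuousOn g K)
    (hi : InjOn g K) [Nonempty X] : ContinuousOn (invFunOn g K) (g '' K) := by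
  have hσ : ∀ r ∈ K, invFunOn g K (g r) = r := fun r hr => hi.leftInvOn_invFunOn hr
  rw [continuousOn_iff_isClosed]
  intro t ht
  refine ⟨g '' (K ∩ t), ((hK.inter_right ht).image_of_continuousOn
    (hg.mono inter_subset_left)).isClosed, ?_⟩
  ext x
  constructor
  · rintro ⟨h1, r, hr, rfl⟩
    refine ⟨⟨r, ⟨hr, ?_⟩, rfl⟩, r, hr, rfl⟩
    rwa [mem_preimage, hσ r hr] at h1
  · rintro ⟨⟨r, ⟨hr, hrt⟩, rfl⟩, h⟩
    refine ⟨?_, h⟩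
    rw [mem_preimage, hσ r hr]; exact hrt

theorem Lin.arc [CompactSpace X] [T2Space X] [TopologicalSpace.SeparableSpace X]
    {P : GPar X} {A B : Set X} {F : Set P.E} (hAB : Disjoint A B) (hAV : A ⊆ P.V)
    {S : P.E → Set X} {K : Set X} (L : P.Lin A B F S K) :
    ∃ f : unitInterval → X, Continuous f ∧ Injective f ∧ f 0 ∈ A ∧ f 1 ∈ B ∧ range f ⊆ K := by
  have hcount : F.Countable := by
    refine Set.PairwiseDisjoint.countable_of_isOpen (s := P.ed) ?_ (fun e _ => P.op e)
      (fun e _ => P.ed_ne e)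
    intro e _ f _ hef
    change Disjoint (P.ed e) (P.ed f)
    rw [disjoint_left]
    exact fun x h1 h2 => hef (P.ed_unique h1 h2)
  letI := hcount.toEncodable
  choose g gc g0 g1 ge gi using fun e : F => L.exists_g e.2
  have gI : ∀ e, ∀ x ∈ K, g e x ∈ Icc (0:ℝ) 1 := by
    intro e x hx
    rcases L.tri e.2 hx with h | h | h
    · rw [g0 e x h]; simp
    · rw [g1 e x h]; simp
    · exact Ioo_subset_Icc_self (ge e x h)
  let w : F → ℝ := fun e => (1/2 : ℝ) ^ (Encodable.encode e)
  have hw : Summable w := summable_geometric_two_encode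
  have wpos : ∀ e, 0 < w e := fun e => by positivity
  have bd : ∀ e x, x ∈ K → ‖w e * g e x‖ ≤ w e := by
    intro e x hx
    have := gI e x hx
    rw [Real.norm_eq_abs, abs_of_nonneg (mul_nonneg (wpos e).le this.1)]
    exact mul_le_of_le_one_right (wpos e).le this.2
  let G : X → ℝ := fun x => ∑' e, w e * g e x
  have hs : ∀ x ∈ K, Summable fun e => w e * g e x := fun x hx =>
    hw.of_norm_bounded (fun e => bd e x hx)
  have Gc : ContinuousOn G K := continuousOn_tsum (fun e => continuousOn_const.mul (gc e)) hw bd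
  have mono : ∀ x ∈ K, ∀ y ∈ K, ∀ e, g e x < g e y → ∀ f, g f x ≤ g f y := by
    intro x hx y hy e hlt f
    by_cases hef : e = f
    · subst hef; exact hlt.le
    rcases L.coh e.2 f.2 (fun h => hef (Subtype.ext h)) with h | h
    · have : x ∉ P.side (P.V \ S e) := fun hh => by
        rw [g1 e x hh] at hlt
        exact absurd (gI e y hy).2 (not_le.2 hlt)
      rw [g0 f x (h x hx this)]; exact (gI f y hy).1
    · have : y ∉ P.side (S e) := fun hh => by
        rw [g0 e y hh] at hlt
        exact absurd (gI e x hx).1 (not_le.2 hlt)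
      rw [g1 f y (h y hy this)]; exact (gI f x hx).2
  have lt : ∀ x ∈ K, ∀ y ∈ K, ∀ e, g e x < g e y → G x < G y := by
    intro x hx y hy e hlt
    exact Summable.tsum_lt_tsum (i := e)
      (fun f => mul_le_mul_of_nonneg_left (mono x hx y hy e hlt f) (wpos f).le)
      (mul_lt_mul_of_pos_left hlt (wpos e)) (hs x hx) (hs y hy)
  have sepa : ∀ x ∈ K, ∀ y ∈ K, (∀ e, g e x = g e y) → x = y := by
    have aux : ∀ x ∈ K, ∀ y ∈ K, (∀ e, g e x = g e y) → x ∉ P.V → x = y := by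
      intro x hx y hy h hxV
      obtain ⟨e, he⟩ := P.ed_cov hxV
      have heF := L.only e x hx he
      have h1 := ge ⟨e, heF⟩ x he
      have h2 := h ⟨e, heF⟩
      rcases L.tri heF hy with hh | hh | hh
      · rw [h2, g0 ⟨e, heF⟩ y hh] at h1; exact absurd h1.1 (lt_irrefl _)
      · rw [h2, g1 ⟨e, heF⟩ y hh] at h1; exact absurd h1.2 (lt_irrefl _)
      · exact gi ⟨e, heF⟩ he hh h2
    intro x hx y hy h
    by_cases hxV : x ∈ P.V
    · by_cases hyV : y ∈ P.V
      · refine L.separates hx hy hxV hyV fun e he => ?_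
        have h2 := h ⟨e, he⟩
        by_cases hxS : x ∈ S e <;> by_cases hyS : y ∈ S e
        · tauto
        · rw [g0 ⟨e, he⟩ x (Or.inl hxS), g1 ⟨e, he⟩ y (Or.inl ⟨hyV, hyS⟩)] at h2
          norm_num at h2
        · rw [g1 ⟨e, he⟩ x (Or.inl ⟨hxV, hxS⟩), g0 ⟨e, he⟩ y (Or.inl hyS)] at h2
          norm_num at h2
        · tauto
      · exact (aux y hy x hx (fun e => (h e).symm) hyV).symm
    · exact aux x hx y hy h hxV
  have Gi : InjOn G K := by
    intro x hx y hy h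
    refine sepa x hx y hy fun e => ?_
    rcases lt_trichotomy (g e x) (g e y) with h1 | h1 | h1
    · exact absurd h (lt x hx y hy e h1).ne
    · exact h1
    · exact absurd h (lt y hy x hx e h1).ne'
  obtain ⟨a, haK, ha⟩ := L.neA
  obtain ⟨b, hbK, hb⟩ := L.neB
  haveI : Nonempty X := ⟨a⟩
  have ga : ∀ e, g e a = 0 := fun e => g0 e a (Or.inl ((L.sep e e.2).2.1 ha))
  have gb : ∀ e, g e b = 1 := fun e => g1 e b (Or.inl ((L.sep e e.2).2.2 hb))
  have hGa : G a = 0 := by simp [G, ga]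
  have hGb : G b = ∑' e, w e := by simp [G, gb]
  have hab : a ≠ b := fun h => hAB.le_bot ⟨ha, h ▸ hb⟩
  have hM : 0 < G b := by
    refine lt_of_le_of_ne ?_ (fun h => hab (Gi haK hbK (hGa.trans h)))
    exact tsum_nonneg fun e => mul_nonneg (wpos e).le (gI e b hbK).1
  have hIcc : ∀ t ∈ Icc (0:ℝ) 1, G b * t ∈ G '' K := by
    intro t ht
    apply L.pre.intermediate_value haK hbK Gc
    rw [hGa]
    exact ⟨mul_nonneg hM.le ht.1, mul_le_of_le_one_right hM.le ht.2⟩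
  have hinv : ∀ r ∈ G '' K, G (invFunOn G K r) = r := fun r hr => invFunOn_eq hr
  have hinvK : ∀ r ∈ G '' K, invFunOn G K r ∈ K := fun r hr => invFunOn_mem hr
  refine ⟨fun t => invFunOn G K (G b * t), ?_, ?_, ?_, ?_, ?_⟩
  · exact (inv_cont L.closed.isCompact Gc Gi).comp_continuous
      (continuous_const.mul continuous_subtype_val) (fun t => hIcc t t.2)
  · intro s t hst
    have h1 := hinv _ (hIcc s s.2)
    have h2 := hinv _ (hIcc t t.2)
    simp only at hst
    rw [hst, h2] at h1
    exact Subtype.ext (mul_left_cancel₀ hM.ne' h1).symm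
  · have : invFunOn G K (G a) = a := Gi.leftInvOn_invFunOn haK
    rw [hGa] at this
    simpa [this] using ha
  · have : invFunOn G K (G b) = b := Gi.leftInvOn_invFunOn hbK
    simpa [this] using hb
  · rintro _ ⟨t, rfl⟩
    exact hinvK _ (hIcc t t.2)

end GPar

namespace GPar

theorem ed_inj (P : GPar X) : Injective P.ed := by
  intro e f h
  obtain ⟨x, hx⟩ := P.ed_ne e
  exact P.ed_unique hx (h ▸ hx)

theorem comp_eq (P : GPar X) {e : P.E} {x : X} (hx : x ∈ P.ed e) :
    connectedComponentIn (P.V)ᶜ x = P.ed e := by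
  have hsub : P.ed e ⊆ (P.V)ᶜ := fun y hy => P.ed_notV hy
  apply Subset.antisymm
  · have hop : IsOpen (⋃ f ∈ {f | f ≠ e}, P.ed f) := isOpen_biUnion fun f _ => P.op f
    refine isPreconnected_connectedComponentIn.subset_left_of_subset_union (P.op e) hop ?_ ?_
      ⟨x, mem_connectedComponentIn (hsub hx), hx⟩
    · rw [disjoint_left]
      intro y hy hy'
      simp only [mem_iUnion] at hy'
      obtain ⟨f, hf, hyf⟩ := hy'
      exact hf (P.ed_unique hyf hy)
    · intro y hy
      obtain ⟨f, hf⟩ := P.ed_cov (connectedComponentIn_subset _ _ hy)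
      by_cases hfe : f = e
      · exact Or.inl (hfe ▸ hf)
      · exact Or.inr (mem_biUnion (show f ∈ {f | f ≠ e} from hfe) hf)
  · exact (P.ed_pre e).subset_connectedComponentIn hx hsub

theorem isEdge_iff (P : GPar X) (G : GraphLike X) (h : P.V = G.V) (s : Set X) :
    G.IsEdge s ↔ ∃ e, s = P.ed e := by
  unfold GraphLike.IsEdge
  rw [← h]
  constructor
  · rintro ⟨x, hx, rfl⟩
    obtain ⟨e, he⟩ := P.ed_cov hx
    exact ⟨e, P.comp_eq he⟩
  · rintro ⟨e, rfl⟩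
    obtain ⟨x, hx⟩ := P.ed_ne e
    exact ⟨x, P.ed_notV hx, (P.comp_eq hx).symm⟩

theorem cut_eq [T2Space X] (P : GPar X) (G : GraphLike X) (h : P.V = G.V) {S : Set X} (hS : S ⊆ P.V) :
    G.cut S (G.V \ S) = P.ed '' {e | P.Ct S e} := by
  ext s
  simp only [GraphLike.cut, Set.mem_ofPred_eq, P.isEdge_iff G h, mem_image]
  rw [← h]
  constructor
  · rintro ⟨⟨e, rfl⟩, ⟨x, hx, hxS⟩, ⟨y, hy, hyV, hyS⟩⟩
    refine ⟨e, ?_, rfl⟩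
    rw [P.cl_eq] at hx hy
    rcases P.mem_cl hx with h1 | h1 | h1
    · exact absurd (hS hxS) (P.ed_notV h1)
    · rcases P.mem_cl hy with h2 | h2 | h2
      · exact absurd hyV (P.ed_notV h2)
      · exact absurd (h1.trans h2.symm ▸ hxS) hyS
      · subst h1 h2; exact Or.inl ⟨hxS, hyS⟩
    · rcases P.mem_cl hy with h2 | h2 | h2
      · exact absurd hyV (P.ed_notV h2)
      · subst h1 h2; exact Or.inr ⟨hyS, hxS⟩
      · exact absurd (h1.trans h2.symm ▸ hxS) hyS
  · rintro ⟨e, he, rfl⟩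
    rw [P.cl_eq]
    obtain ⟨p, q, hp, hq, hpS, hqS, _⟩ := P.ends he
    exact ⟨⟨e, rfl⟩, ⟨p, hp, hpS⟩, ⟨q, hq, hqS⟩⟩

end GPar

/-- **Menger, edge-disjoint version.** For disjoint closed sets of
vertices `A`, `B` of a graph-like continuum, the maximum number of pairwise
edge-disjoint arcs from `A` to `B` equals the minimum size of a cut separating `A`
from `B`. -/
theorem menger_edge_disjoint
    [CompactSpace X] [TopologicalSpace.MetrizableSpace X] [ConnectedSpace X]
    (G : GraphLike X) {A B : Set X} (hAV : A ⊆ G.V) (hBV : B ⊆ G.V)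
    (hA : IsClosed A) (hB : IsClosed B) (hAB : Disjoint A B) :
    ∃ k : ℕ, IsGreatest (G.arcConn A B) k ∧
      IsLeast {n : ℕ | ∃ S : Set X, G.ClopenIn S ∧ A ⊆ S ∧ B ⊆ G.V \ S ∧
        (G.cut S (G.V \ S)).Finite ∧ (G.cut S (G.V \ S)).ncard = n} k := by
  classical
  letI : MetricSpace X := TopologicalSpace.metrizableSpaceMetric X
  haveI : T2Space X := inferInstance
  haveI : TopologicalSpace.SeparableSpace X := inferInstance
  obtain ⟨P, hPV⟩ := GraphLike.exists_gpar G.V G.closedV G.zeroDimV G.E G.homeo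
  have hAV' : A ⊆ P.V := hPV ▸ hAV
  have hBV' : B ⊆ P.V := hPV ▸ hBV
  have hclo : ∀ S, G.ClopenIn S ↔ P.Clo S := fun S => by
    unfold GraphLike.ClopenIn GPar.Clo; rw [hPV]
  let c : Set X → ℕ := fun S => {e | P.Ct S e}.ncard
  have hcut : ∀ S, P.Clo S → (G.cut S (G.V \ S)).Finite ∧ (G.cut S (G.V \ S)).ncard = c S := by
    intro S hS
    rw [P.cut_eq G hPV hS.1]
    exact ⟨(P.cut_finite hS).image _, Set.ncard_image_of_injective _ P.ed_inj⟩
  obtain ⟨C, hCV, hC1, hC2, hC3, hC4⟩ := sepV (A := A) (B := B) P.closedV P.tdV hA hB hAV' hAB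
  have hne : (c '' {S | P.Sep A B S}).Nonempty := ⟨_, C, ⟨⟨hCV, hC1, hC2⟩, hC3, fun b hb =>
    ⟨hBV' hb, fun h => hC4.le_bot ⟨h, hb⟩⟩⟩, rfl⟩
  obtain ⟨S0, hS0, hS0k⟩ := Nat.sInf_mem hne
  set k := sInf (c '' {S | P.Sep A B S}) with hk
  have hle : ∀ S, P.Sep A B S → k ≤ c S := fun S hS => Nat.sInf_le ⟨S, hS, rfl⟩
  refine ⟨k, ⟨?_, ?_⟩, ⟨S0, (hclo S0).2 hS0.1, hS0.2.1, hPV ▸ hS0.2.2, (hcut S0 hS0.1).1,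
    (hcut S0 hS0.1).2.trans hS0k⟩, ?_⟩
  · obtain ⟨col, hcol⟩ := P.colouring hAV' hBV' k hle
    have hl : ∀ i : Fin k, ∃ F ⊆ {e | (col e : ℕ) = i}, ∃ S K, P.Lin A B F S K := fun i =>
      P.exists_lin hAV' hBV' hA hB hAB _ (fun S hS => by
        obtain ⟨e, he, hc⟩ := hcol S hS i i.2
        exact ⟨e, hc, he⟩)
    choose F hF S K L using hl
    choose f fc fi f0 f1 fK using fun i => (L i).arc hAB hAV'
    refine ⟨f, fun i => ⟨fc i, fi i, f0 i, f1 i⟩, ?_⟩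
    rintro i j hij s hs ⟨h1, h2⟩
    obtain ⟨e, rfl⟩ := (P.isEdge_iff G hPV s).1 hs
    obtain ⟨x, hx⟩ := P.ed_ne e
    have m1 : (col e : ℕ) = i := hF i ((L i).only e x (fK i (h1 hx)) hx)
    have m2 : (col e : ℕ) = j := hF j ((L j).only e x (fK j (h2 hx)) hx)
    exact hij (Fin.ext (m1.symm.trans m2))
  · rintro n ⟨f, hf, hd⟩
    have : ∀ i, ∃ e, P.Ct S0 e ∧ P.ed e ⊆ range (f i) := fun i =>
      P.cross hS0.1 (isPreconnected_range (hf i).1) ⟨f i 0, ⟨0, rfl⟩, hS0.2.1 (hf i).2.2.1⟩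
        ⟨f i 1, ⟨1, rfl⟩, hS0.2.2 (hf i).2.2.2⟩
    choose e he hef using this
    have hinj : Injective e := by
      intro i j hij
      by_contra hne
      exact hd i j hne (P.ed (e i)) ((P.isEdge_iff G hPV _).2 ⟨_, rfl⟩) ⟨hef i, hij ▸ hef j⟩
    have h1 : (range e).ncard = n := by
      rw [← image_univ, Set.ncard_image_of_injective _ hinj, Set.ncard_univ, Nat.card_eq_fintype_card,
        Fintype.card_fin]
    rw [← h1, ← hS0k]
    refine Set.ncard_le_ncard ?_ (P.cut_finite hS0.1)
    rintro _ ⟨i, rfl⟩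
    exact he i
  · rintro n ⟨S, hS, hSA, hSB, _, hn⟩
    have hS' := (hclo S).1 hS
    rw [← hn, (hcut S hS').2]
    exact hle S ⟨hS', hSA, hPV ▸ hSB⟩
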